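/- arXiv:2106.12148 — 2 statements merged into one kernel-verified Lean document; each statement's English description precedes it below -/
import Mathlib

section
/- Let G be a unicyclic graph of order n ≥ 6 (i.e., a connected graph containing exactly one cycle). Then G is almost self-centered if and only if n is odd and G is isomorphic to the graph obtained from the cycle C_{n−1} by attaching one pendant edge (adding a new vertex joined to exactly one vertex of the cycle). -/
open SimpleGraph

/-- The eccentricity of a vertex `v`: the maximum distance from `v` to any vertex. -/
noncomputable def graphEcc {V : Type*} [Fintype V] (G : SimpleGraph V) (v : V) : ℕ :=
  Finset.univ.sup fun u => G.dist v u

/-- The radius of a graph: the minimum eccentricity over all vertices. -/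
noncomputable def graphRadius {V : Type*} [Fintype V] (G : SimpleGraph V) : ℕ :=
  sInf (Set.range (graphEcc G))

/-- The diameter of a graph: the maximum eccentricity over all vertices. -/
noncomputable def graphDiam {V : Type*} [Fintype V] (G : SimpleGraph V) : ℕ :=
  Finset.univ.sup (graphEcc G)

/-- A connected graph of order `n` is almost self-centered if it has exactly `n - 2`
central vertices (vertices whose eccentricity equals the radius). -/
def IsAlmostSelfCentered {V : Type*} [Fintype V] (G : SimpleGraph V) : Prop :=
  G.Connected ∧ Nat.card {v : V | graphEcc G v = graphRadius G} = Fintype.card V - 2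

/-- A connected graph of order `n` is almost peripheral if it has exactly `n - 1`
peripheral vertices (vertices whose eccentricity equals the diameter). -/
def IsAlmostPeripheral {V : Type*} [Fintype V] (G : SimpleGraph V) : Prop :=
  G.Connected ∧ Nat.card {v : V | graphEcc G v = graphDiam G} = Fintype.card V - 1

/-- A graph is unicyclic if it is connected and contains exactly one cycle, where a cycle
is identified with the set of its edges. -/
def Unicyclic {V : Type*} (G : SimpleGraph V) : Prop :=
  G.Connected ∧ ∃! s : Set (Sym2 V),
    ∃ (v : V) (w : G.Walk v v), w.IsCycle ∧ {e | e ∈ w.edges} = s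

/-- The graph obtained from the cycle `C_m` by attaching one pendant edge:
a new vertex is joined to exactly one vertex of the cycle. -/
def cyclePlusPendant (m : ℕ) : SimpleGraph (Fin m ⊕ Unit) :=
  SimpleGraph.fromRel fun a b =>
    match a, b with
    | Sum.inl i, Sum.inl j => (SimpleGraph.cycleGraph m).Adj i j
    | Sum.inl i, Sum.inr _ => (i : ℕ) = 0
    | _, _ => False

set_option linter.unusedSectionVars false
section helpers

variable {V : Type*} [Fintype V] {G : SimpleGraph V}

lemma dist_le_ecc (x y : V) : G.dist x y ≤ graphEcc G x :=
  Finset.le_sup (f := fun u => G.dist x u) (Finset.mem_univ y)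

lemma ecc_le {x : V} {k : ℕ} (h : ∀ y, G.dist x y ≤ k) : graphEcc G x ≤ k :=
  Finset.sup_le fun y _ => h y

lemma exists_dist_eq_ecc (x : V) : ∃ y, G.dist x y = graphEcc G x := by
  obtain ⟨y, _, hy⟩ := Finset.exists_mem_eq_sup Finset.univ ⟨x, Finset.mem_univ x⟩
    (fun u => G.dist x u)
  exact ⟨y, hy.symm⟩

lemma radius_le (x : V) : graphRadius G ≤ graphEcc G x := Nat.sInf_le ⟨x, rfl⟩

lemma exists_ecc_eq_radius [Nonempty V] : ∃ x, graphEcc G x = graphRadius G :=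
  Nat.sInf_mem (Set.range_nonempty (graphEcc G))

/-- `u` is a leaf with neighbour `s`. -/
def LeafAt (G : SimpleGraph V) (u s : V) : Prop := ∀ x, G.Adj u x ↔ x = s

lemma LeafAt.dist_eq (hc : G.Connected) {u s x : V} (h : LeafAt G u s) (hx : x ≠ u) :
    G.dist u x = G.dist s x + 1 := by
  have hadj : G.Adj u s := (h s).2 rfl
  apply le_antisymm
  · have := hc.dist_triangle (u := u) (v := s) (w := x)
    rw [dist_eq_one_iff_adj.2 hadj] at this
    omega
  · obtain ⟨p, hp⟩ := hc.exists_walk_length_eq_dist u x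
    cases p with
    | nil => exact absurd rfl hx
    | cons hh q =>
      have := (h _).1 hh
      subst this
      rw [← hp, Walk.length_cons]
      exact Nat.succ_le_succ (dist_le q)

lemma lipschitz_le_dist (hc : G.Connected) (d : V → ℕ) (hd : ∀ x y, G.Adj x y → d y ≤ d x + 1)
    (x y : V) : d y ≤ d x + G.dist x y := by
  obtain ⟨p, hp⟩ := hc.exists_walk_length_eq_dist x y
  rw [← hp]
  clear hp
  induction p with
  | nil => simp
  | cons hh q ih =>
    have := hd _ _ hh
    rw [Walk.length_cons]
    omega

lemma LeafAt.ecc_eq (hc : G.Connected) {u s : V} (h : LeafAt G u s) (h3 : 3 ≤ Fintype.card V) :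
    graphEcc G u = graphEcc G s + 1 := by
  classical
  have hadj : G.Adj u s := (h s).2 rfl
  apply le_antisymm
  · apply ecc_le
    intro y
    by_cases hy : y = u
    · subst hy; simp
    · rw [h.dist_eq hc hy]
      have := dist_le_ecc (G := G) s y
      omega
  · obtain ⟨y, hy⟩ := exists_dist_eq_ecc (G := G) s
    by_cases hyu : y = u
    · subst hyu
      rw [dist_eq_one_iff_adj.2 hadj.symm] at hy
      obtain ⟨z, hz⟩ := Finset.exists_mem_notMem_of_card_lt_card (s := {y, s}) (t := Finset.univ)
        (by rw [Finset.card_univ]; have := Finset.card_le_two (a := y) (b := s); omega)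
      have h1 := h.dist_eq hc (x := z) (by grind)
      have h2 : 0 < G.dist s z := hc.pos_dist_of_ne (by grind)
      have := dist_le_ecc (G := G) y z
      omega
    · have h1 := h.dist_eq hc hyu
      have := dist_le_ecc (G := G) u y
      omega

lemma closed_univ (hc : G.Connected) (S : Set V) (x : V) (hx : x ∈ S)
    (hS : ∀ a ∈ S, ∀ b, G.Adj a b → b ∈ S) (y : V) : y ∈ S := by
  obtain ⟨p⟩ := hc x y
  induction p with
  | nil => exact hx
  | cons hh q ih => exact ih (hS _ hx _ hh)

/-- distance on the cycle -/
def cd (m i j : ℕ) : ℕ := min ((i - j) + (j - i)) (m - ((i - j) + (j - i)))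

/-- adjacency on the cycle -/
def cadj (m i j : ℕ) : Prop :=
  i + 1 = j ∨ j + 1 = i ∨ (i = 0 ∧ j + 1 = m) ∨ (j = 0 ∧ i + 1 = m)

lemma cycleGraph_adj_iff {m : ℕ} (hm : 3 ≤ m) (i j : Fin m) :
    (cycleGraph m).Adj i j ↔ cadj m i j := by
  rw [cycleGraph_adj', Fin.val_sub, Fin.val_sub, cadj]
  have hi := i.2
  have hj := j.2
  generalize (i : ℕ) = a at *
  generalize (j : ℕ) = b at *
  rcases lt_trichotomy a b with h | h | h
  · rw [Nat.mod_eq_of_lt (a := m - b + a) (by omega), 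
      Nat.mod_eq_sub_mod (a := m - a + b) (by omega), Nat.mod_eq_of_lt (by omega)]
    omega
  · subst h
    rw [show m - a + a = m by omega, Nat.mod_self]
    omega
  · rw [Nat.mod_eq_of_lt (a := m - a + b) (by omega), 
      Nat.mod_eq_sub_mod (a := m - b + a) (by omega), Nat.mod_eq_of_lt (by omega)]
    omega

/-- `G` is a cycle `f 0, …, f (m-1)` with leaves `L` attached. -/
structure Cfg (G : SimpleGraph V) (m : ℕ) (f : Fin m → V) (π : V → Fin m) (L : Set V) : Prop where
  hm : 3 ≤ m
  left_inv : ∀ i, π (f i) = i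
  right_inv : ∀ x, x ∉ L → f (π x) = x
  adj : ∀ i j, G.Adj (f i) (f j) ↔ cadj m i j
  leaf : ∀ x ∈ L, LeafAt G x (f (π x))
  notMem : ∀ i, f i ∉ L

variable {m : ℕ} {f : Fin m → V} {π : V → Fin m} {L : Set V}

lemma Cfg.dist_eq (hc : G.Connected) (h : Cfg G m f π L) (i j : Fin m) :
    G.dist (f i) (f j) = cd m i j := by
  have hm := h.hm
  apply le_antisymm
  · generalize hN : cd m i j = N
    induction N generalizing j with
    | zero =>
      have : i = j := by
        simp only [cd] at hN
        ext; omega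
      subst this
      simp
    | succ N ih =>
      have hi := i.2
      have hj := j.2
      obtain ⟨k, hk, h1, h2⟩ : ∃ k, k < m ∧ cadj m k j ∧ cd m i k = N := by
        simp only [cd, cadj] at *
        by_cases h1 : (i:ℕ) < j
        · by_cases h2 : (j:ℕ) - i ≤ m - (j - i)
          · exact ⟨j - 1, by omega, by omega, by omega⟩
          · by_cases h3 : (j:ℕ) + 1 = m
            · exact ⟨0, by omega, by omega, by omega⟩
            · exact ⟨j + 1, by omega, by omega, by omega⟩
        · by_cases h2 : (i:ℕ) - j ≤ m - (i - j)
          · exact ⟨j + 1, by omega, by omega, by omega⟩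
          · by_cases h3 : (j:ℕ) = 0
            · exact ⟨m - 1, by omega, by omega, by omega⟩
            · exact ⟨j - 1, by omega, by omega, by omega⟩
      have h3 := ih ⟨k, hk⟩ h2
      have h4 := dist_eq_one_iff_adj.2 ((h.adj ⟨k, hk⟩ j).2 h1)
      have := hc.dist_triangle (u := f i) (v := f ⟨k, hk⟩) (w := f j)
      omega
  · have key := lipschitz_le_dist hc (fun x => cd m i (π x)) ?_ (f i) (f j)
    · simp only [h.left_inv] at key
      have : cd m i i = 0 := by simp [cd]
      omega
    · intro x y hxy
      by_cases hx : x ∈ L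
      · have := (h.leaf x hx y).1 hxy
        rw [this, h.left_inv]
        omega
      by_cases hy : y ∈ L
      · have := (h.leaf y hy x).1 hxy.symm
        rw [this, h.left_inv]
        omega
      have hx' := h.right_inv x hx
      have hy' := h.right_inv y hy
      rw [← hx', ← hy', h.adj] at hxy
      have := (π x).2
      have := (π y).2
      have := i.2
      simp only [cd, cadj] at *
      omega

end helpers
section structural

variable {V : Type*} [Fintype V] {G : SimpleGraph V}

open Classical in
lemma sum_degree_of_unicyclic (hG : Unicyclic G) :
    ∑ v, G.degree v = 2 * Fintype.card V := by
  obtain ⟨hc, s, ⟨v, w, hw, rfl⟩, huniq⟩ := hG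
  rw [sum_degrees_eq_twice_card_edges]
  congr 1
  have hlen := hw.three_le_length
  obtain ⟨e, he⟩ : ∃ e, e ∈ w.edges := by
    apply List.exists_mem_of_ne_nil
    intro h
    have := w.length_edges
    rw [h] at this
    simp at this
    omega
  have heG : e ∈ G.edgeSet := w.edges_subset_edgeSet he
  induction e using Sym2.ind with
  | _ x y =>
  have hnb : ¬ G.IsBridge s(x, y) := fun hb => hb.notMem_edges_of_isCycle hw he
  have hconn := hc.connected_delete_edge_of_not_isBridge hnb
  have hac : (G.deleteEdges {s(x, y)}).IsAcyclic := by
    intro a c hcyc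
    have hle : G.deleteEdges {s(x, y)} ≤ G := deleteEdges_le _
    have h1 := huniq _ ⟨a, c.mapLe hle, hcyc.mapLe hle, rfl⟩
    have h2 : s(x, y) ∈ {e | e ∈ w.edges} := he
    rw [← h1] at h2
    simp only [Set.mem_ofPred_eq, Walk.edges_mapLe_eq_edges] at h2
    have := c.edges_subset_edgeSet h2
    simp at this
  have ht : (G.deleteEdges {s(x, y)}).IsTree := ⟨hconn, hac⟩
  have hcard := ht.card_edgeFinset
  have h3 : (G.deleteEdges {s(x, y)}).edgeFinset = G.edgeFinset.erase s(x, y) := by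
    ext e
    simp [and_comm]
  rw [h3, Finset.card_erase_add_one (by simpa using heG)] at hcard
  exact hcard

lemma exists_cfg (hc : G.Connected) {v : V} (w : G.Walk v v) (hw : w.IsCycle) (L : Set V)
    (hleaf : ∀ u ∈ L, ∃ s, s ∉ L ∧ LeafAt G u s)
    (hdeg : ∀ x, x ∉ L → ∃ a b, ∀ y, y ∉ L → G.Adj x y → y = a ∨ y = b) :
    ∃ (m : ℕ) (f : Fin m → V) (π : V → Fin m), Cfg G m f π L ∧ ∀ i : Fin m, i.val = 0 → f i = v := by
  classical
  have hlen := hw.three_le_length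
  set m := w.length with hm
  have hinj := hw.getVert_injOn'
  rw [← hm] at hinj
  have hlast : w.getVert m = w.getVert 0 := by simp [hm]
  have hsucc : ∀ i, i < m → G.Adj (w.getVert i) (w.getVert (i+1)) :=
    fun i hi => w.adj_getVert_succ hi
  -- next and previous
  have hadj1 : ∀ i j, i < m → j < m → cadj m i j → G.Adj (w.getVert i) (w.getVert j) := by
    intro i j hi hj h
    rcases h with h | h | ⟨h, h'⟩ | ⟨h, h'⟩
    · subst h; exact hsucc i hi
    · subst h; exact (hsucc j hj).symm
    · have := hsucc j hj
      rw [h', hlast] at this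
      rw [h]; exact this.symm
    · have := hsucc i hi
      rw [h', hlast] at this
      rw [h]; exact this
  have hinj' : ∀ i j, i < m → j < m → w.getVert i = w.getVert j → i = j := by
    intro i j hi hj h
    exact hinj (by simp; omega) (by simp; omega) h
  have hnb : ∀ i, i < m → ∃ j k, j < m ∧ k < m ∧ j ≠ k ∧ cadj m i j ∧ cadj m i k := by
    intro i hi
    simp only [cadj]
    by_cases h0 : i = 0
    · exact ⟨1, m - 1, by omega, by omega, by omega, by omega, by omega⟩
    by_cases h1 : i + 1 = m
    · exact ⟨0, i - 1, by omega, by omega, by omega, by omega, by omega⟩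
    · exact ⟨i + 1, i - 1, by omega, by omega, by omega, by omega, by omega⟩
  have hnl : ∀ i, i < m → w.getVert i ∉ L := by
    intro i hi hL
    obtain ⟨s, _, hs⟩ := hleaf _ hL
    obtain ⟨j, k, hj, hk, hne, h1, h2⟩ := hnb i hi
    have e1 := (hs _).1 (hadj1 i j hi hj h1)
    have e2 := (hs _).1 (hadj1 i k hi hk h2)
    exact hne (hinj' j k hj hk (e1.trans e2.symm))
  have hall : ∀ i, i < m → ∀ y, y ∉ L → G.Adj (w.getVert i) y →
      ∃ j, j < m ∧ cadj m i j ∧ y = w.getVert j := by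
    intro i hi y hy hadj
    obtain ⟨j, k, hj, hk, hne, h1, h2⟩ := hnb i hi
    obtain ⟨a, b, hab⟩ := hdeg _ (hnl i hi)
    have e1 := hab _ (hnl j hj) (hadj1 i j hi hj h1)
    have e2 := hab _ (hnl k hk) (hadj1 i k hi hk h2)
    have e3 := hab y hy hadj
    have hne' : w.getVert j ≠ w.getVert k := fun h => hne (hinj' j k hj hk h)
    have : y = w.getVert j ∨ y = w.getVert k := by grind
    rcases this with h | h
    · exact ⟨j, hj, h1, h⟩
    · exact ⟨k, hk, h2, h⟩
  have hcover : ∀ x, (x ∉ L ∧ ∃ i, i < m ∧ w.getVert i = x) ∨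
      (x ∈ L ∧ ∃ i, i < m ∧ LeafAt G x (w.getVert i)) := by
    intro x
    refine closed_univ hc {x | (x ∉ L ∧ ∃ i, i < m ∧ w.getVert i = x) ∨
      (x ∈ L ∧ ∃ i, i < m ∧ LeafAt G x (w.getVert i))} (w.getVert 0)
      (Or.inl ⟨hnl 0 (by omega), 0, by omega, rfl⟩) ?_ x
    rintro a (⟨ha, i, hi, rfl⟩ | ⟨ha, i, hi, hla⟩) b hab
    · by_cases hb : b ∈ L
      · right
        obtain ⟨s, _, hs⟩ := hleaf b hb
        refine ⟨hb, i, hi, ?_⟩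
        rw [(hs _).1 hab.symm]
        exact hs
      · left
        obtain ⟨j, hj, _, rfl⟩ := hall i hi b hb hab
        exact ⟨hb, j, hj, rfl⟩
    · left
      rw [(hla _).1 hab]
      exact ⟨hnl i hi, i, hi, rfl⟩
  have hπ : ∀ x, ∃ i : Fin m, (x ∉ L → w.getVert i = x) ∧ (x ∈ L → LeafAt G x (w.getVert i)) := by
    intro x
    rcases hcover x with ⟨h, i, hi, h'⟩ | ⟨h, i, hi, h'⟩
    · exact ⟨⟨i, hi⟩, fun _ => h', fun h2 => absurd h2 h⟩
    · exact ⟨⟨i, hi⟩, fun h2 => absurd h h2, fun _ => h'⟩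
  choose π hπ1 hπ2 using hπ
  refine ⟨m, fun i => w.getVert i, π, ⟨hlen, ?_, hπ1, ?_, hπ2, fun i => hnl i i.2⟩, ?_⟩
  · intro i
    ext
    exact hinj' _ _ (π _).2 i.2 (hπ1 _ (hnl i i.2))
  · intro i j
    refine ⟨fun h => ?_, hadj1 i j i.2 j.2⟩
    obtain ⟨k, hk, hik, e⟩ := hall i i.2 _ (hnl j j.2) h
    rw [hinj' j k j.2 hk e]
    exact hik
  · intro i hi
    simp [hi]

lemma exists_cfg_at (hc : G.Connected) {v : V} (w : G.Walk v v) (hw : w.IsCycle) (L : Set V)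
    (hleaf : ∀ u ∈ L, ∃ s, s ∉ L ∧ LeafAt G u s)
    (hdeg : ∀ x, x ∉ L → ∃ a b, ∀ y, y ∉ L → G.Adj x y → y = a ∨ y = b) (s : V)
    (hs : s ∉ L) :
    ∃ (m : ℕ) (f : Fin m → V) (π : V → Fin m), Cfg G m f π L ∧ (π s).val = 0 := by
  classical
  -- the support of the cycle together with its leaves is everything
  have hmem : s ∈ w.support := by
    by_contra hcon
    have h2 : ∀ x ∈ w.support, ∃ a b, a ∈ w.support ∧ b ∈ w.support ∧ a ≠ b ∧ G.Adj x a ∧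
        G.Adj x b := by
      intro x hx
      have hw' := hw.rotate hx
      have hl := hw'.three_le_length
      have hp : ∀ y, y ∈ (w.rotate x hx).support → y ∈ w.support := fun y hy =>
        (w.mem_support_rotate_iff x hx).1 hy
      refine ⟨_, _, hp _ ((w.rotate x hx).getVert_mem_support 1),
        hp _ ((w.rotate x hx).getVert_mem_support ((w.rotate x hx).length - 1)), ?_, ?_, ?_⟩
      · intro h
        have := hw'.getVert_injOn ⟨by omega, by omega⟩ ⟨by omega, by omega⟩ h
        omega
      · have := (w.rotate x hx).adj_getVert_succ (i := 0) (by omega)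
        simpa using this
      · have := (w.rotate x hx).adj_getVert_succ (i := (w.rotate x hx).length - 1) (by omega)
        rw [show (w.rotate x hx).length - 1 + 1 = (w.rotate x hx).length by omega,
          Walk.getVert_length] at this
        exact this.symm
    have h3 : ∀ x ∈ w.support, x ∉ L := by
      intro x hx hL
      obtain ⟨t, _, ht⟩ := hleaf x hL
      obtain ⟨a, b, _, _, hab, h1, h2⟩ := h2 x hx
      exact hab (((ht a).1 h1).trans ((ht b).1 h2).symm)
    have := closed_univ hc {x | x ∈ w.support ∨ (x ∈ L ∧ ∃ t ∈ w.support, LeafAt G x t)} v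
      (Or.inl w.start_mem_support) ?_ s
    · rcases this with h | h
      · exact hcon h
      · exact hs h.1
    rintro a (ha | ⟨_, t, ht, hla⟩) b hab
    · by_cases hb : b ∈ L
      · obtain ⟨t, _, ht⟩ := hleaf b hb
        exact Or.inr ⟨hb, a, ha, (ht a).1 hab.symm ▸ ht⟩
      · left
        obtain ⟨p, q, hp, hq, hpq, h4, h5⟩ := h2 a ha
        obtain ⟨c, d, hcd⟩ := hdeg a (h3 a ha)
        have e1 := hcd p (h3 p hp) h4
        have e2 := hcd q (h3 q hq) h5
        have e3 := hcd b hb hab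
        have : b = p ∨ b = q := by grind
        rcases this with rfl | rfl <;> assumption
    · left
      rw [(hla b).1 hab]
      exact ht
  obtain ⟨m, f, π, h, h0⟩ := exists_cfg hc (w.rotate s hmem) (hw.rotate hmem) L hleaf hdeg
  refine ⟨m, f, π, h, ?_⟩
  have hm := h.hm
  have := h0 ⟨0, by omega⟩ rfl
  rw [← this, h.left_inv]

end structural
section asc

variable {V : Type*} [Fintype V] {G : SimpleGraph V}

/-- All vertices except `u`, `v` are central. -/
structure Asc (G : SimpleGraph V) (u v : V) : Prop where
  ne : u ≠ v
  hu : graphEcc G u ≠ graphRadius G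
  hv : graphEcc G v ≠ graphRadius G
  cen : ∀ x, x ≠ u → x ≠ v → graphEcc G x = graphRadius G

lemma exists_asc (h2 : 2 ≤ Fintype.card V) (h : IsAlmostSelfCentered G) : ∃ u v, Asc G u v := by
  classical
  have h1 := h.2
  have h3 : {v : V | graphEcc G v ≠ graphRadius G}.ncard = 2 := by
    have := Set.ncard_add_ncard_compl {v : V | graphEcc G v = graphRadius G}
    rw [← Nat.card_coe_set_eq, h1, Nat.card_eq_fintype_card] at this
    have h4 : {v : V | graphEcc G v = graphRadius G}ᶜ = {v : V | graphEcc G v ≠ graphRadius G} := rfl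
    rw [h4] at this
    omega
  obtain ⟨u, v, hne, huv⟩ := Set.ncard_eq_two.1 h3
  have key : ∀ x, graphEcc G x ≠ graphRadius G ↔ (x = u ∨ x = v) := by
    intro x
    have : x ∈ {v : V | graphEcc G v ≠ graphRadius G} ↔ x ∈ ({u, v} : Set V) := by rw [huv]
    simpa using this
  refine ⟨u, v, hne, (key u).2 (Or.inl rfl), (key v).2 (Or.inr rfl), ?_⟩
  intro x hx hx'
  by_contra hh
  rcases (key x).1 hh with h | h <;> contradiction

variable {u v : V}

lemma Asc.symm (h : Asc G u v) : Asc G v u :=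
  ⟨h.ne.symm, h.hv, h.hu, fun x h1 h2 => h.cen x h2 h1⟩

/-- any three distinct vertices include a central one -/
lemma Asc.three (h : Asc G u v) {a b c : V} (hab : a ≠ b) (hac : a ≠ c) (hbc : b ≠ c)
    (ha : graphEcc G a ≠ graphRadius G) (hb : graphEcc G b ≠ graphRadius G) :
    graphEcc G c = graphRadius G := by
  by_contra hcc
  have h1 := h.cen a
  have h2 := h.cen b
  have h3 := h.cen c
  by_cases a1 : a = u <;> by_cases a2 : a = v <;> by_cases b1 : b = u <;> by_cases b2 : b = v <;>
    by_cases c1 : c = u <;> by_cases c2 : c = v <;> simp_all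

lemma Asc.leaf_mem (hc : G.Connected) (h3 : 3 ≤ Fintype.card V) (h : Asc G u v) {l s : V}
    (hl : LeafAt G l s) : l = u ∨ l = v := by
  by_contra hcon
  have h1 := h.cen l (by grind) (by grind)
  have h2 := hl.ecc_eq hc h3
  have h4 := radius_le (G := G) s
  omega

lemma Asc.leaf_facts (hc : G.Connected) (h3 : 3 ≤ Fintype.card V) (h : Asc G u v) {s : V}
    (hl : LeafAt G u s) : graphEcc G s = graphRadius G ∧ graphEcc G u = graphRadius G + 1 ∧
      G.dist u v = graphRadius G + 1 := by
  have h2 := hl.ecc_eq hc h3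
  have h4 := radius_le (G := G) s
  obtain ⟨x, hx⟩ := exists_dist_eq_ecc (G := G) u
  have h5 := dist_le_ecc (G := G) x u
  rw [dist_comm] at h5
  have hxu : x ≠ u := by
    rintro rfl
    simp at hx
    omega
  have hxv : x = v := by
    by_contra hxv
    have := h.cen x hxu hxv
    omega
  subst hxv
  have hadj : G.Adj u s := (hl s).2 rfl
  have hs : s ≠ x := by
    rintro rfl
    rw [dist_eq_one_iff_adj.2 hadj] at hx
    have := h.hv
    omega
  have h6 := h.cen s hadj.ne' hs
  exact ⟨h6, by omega, by omega⟩

open Classical in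
lemma exists_fresh (s : Finset V) {k : ℕ} (hs : s.card ≤ k) (hk : k < Fintype.card V) :
    ∃ z, z ∉ s := by
  obtain ⟨z, _, hz⟩ := Finset.exists_mem_notMem_of_card_lt_card (s := s) (t := Finset.univ)
        (by rw [Finset.card_univ]; omega)
  exact ⟨z, hz⟩

lemma Asc.not_same (hc : G.Connected) (h4 : 4 ≤ Fintype.card V) (h : Asc G u v) {s : V}
    (hl : LeafAt G u s) (hl' : LeafAt G v s) : False := by
  classical
  obtain ⟨h1, h2, h3⟩ := h.leaf_facts hc (by omega) hl
  have h5 := hl.dist_eq hc h.ne.symm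
  have h6 : G.dist s v = 1 := dist_eq_one_iff_adj.2 ((hl' s).2 rfl).symm
  obtain ⟨z, hz⟩ := exists_fresh {u, v, s} Finset.card_le_three (by omega)
  simp only [Finset.mem_insert, Finset.mem_singleton, not_or] at hz
  have h7 := hl.dist_eq hc hz.1
  have h8 : 0 < G.dist s z := hc.pos_dist_of_ne (by grind)
  have h9 := dist_le_ecc (G := G) z u
  rw [dist_comm] at h9
  have := h.cen z hz.1 hz.2.1
  omega

/-- the neighbour of a leaf has degree at least three -/
lemma Asc.not_two (hc : G.Connected) (h6 : 6 ≤ Fintype.card V) (h : Asc G u v) {s z : V}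
    (hl : LeafAt G u s) (hs : ∀ x, G.Adj s x → x = u ∨ x = z) (hz : G.Adj s z) (hzu : z ≠ u) :
    False := by
  classical
  obtain ⟨h1, h2, h3⟩ := h.leaf_facts hc (by omega) hl
  have hus : G.Adj u s := (hl s).2 rfl
  have hd : ∀ x, x ≠ u → x ≠ s → G.dist s x = G.dist z x + 1 := by
    intro x hxu hxs
    apply le_antisymm
    · have := hc.dist_triangle (u := s) (v := z) (w := x)
      rw [dist_eq_one_iff_adj.2 hz] at this
      omega
    · obtain ⟨p, hp⟩ := hc.exists_walk_length_eq_dist s x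
      cases p with
      | nil => exact absurd rfl hxs
      | @cons _ y _ hh q =>
        rw [Walk.length_cons] at hp
        have hq := dist_le q
        rcases hs _ hh with rfl | rfl
        · have := hl.dist_eq hc hxu
          omega
        · omega
  have hr : 3 ≤ graphRadius G := by
    obtain ⟨x, hx⟩ := exists_fresh {u, v, s, z} Finset.card_le_four (by omega)
    simp only [Finset.mem_insert, Finset.mem_singleton, not_or] at hx
    have e1 := hl.dist_eq hc hx.1
    have e2 := hd x hx.1 hx.2.2.1
    have e3 : 0 < G.dist z x := hc.pos_dist_of_ne (by grind)
    have e4 := dist_le_ecc (G := G) x u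
    rw [dist_comm] at e4
    have := h.cen x hx.1 hx.2.1
    omega
  have hez : graphEcc G z ≤ graphRadius G - 1 := by
    apply ecc_le
    intro x
    by_cases hxs : x = s
    · subst hxs
      rw [dist_eq_one_iff_adj.2 hz.symm]
      omega
    by_cases hxu : x = u
    · subst hxu
      rw [dist_comm, hl.dist_eq hc hzu, dist_eq_one_iff_adj.2 hz]
      omega
    have := hd x hxu hxs
    have := dist_le_ecc (G := G) s x
    omega
  have := radius_le (G := G) z
  omega

open Classical in
lemma Asc.struct_facts (hc : G.Connected) (h6 : 6 ≤ Fintype.card V) (h : Asc G u v)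
    (hsum : ∑ v, G.degree v = 2 * Fintype.card V) :
    ∃ L : Set V, L ⊆ {u, v} ∧ (∀ u ∈ L, ∃ s, s ∉ L ∧ LeafAt G u s) ∧
    (∀ x, x ∉ L → ∃ a b, ∀ y, y ∉ L → G.Adj x y → y = a ∨ y = b) ∧
    (∀ x ∈ L, ∀ y ∈ L, ∀ s, LeafAt G x s → LeafAt G y s → x = y) := by
  have hpos : ∀ x, 0 < G.degree x := by
    have : Nontrivial V := Fintype.one_lt_card_iff_nontrivial.1 (by omega)
    intro x
    exact hc.preconnected.degree_pos_of_nontrivial x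
  set L : Finset V := Finset.univ.filter (fun x => G.degree x = 1) with hL
  have hleaf0 : ∀ x ∈ L, ∃ s, LeafAt G x s := by
    intro x hx
    rw [hL, Finset.mem_filter] at hx
    obtain ⟨s, hs⟩ := Finset.card_eq_one.1 hx.2
    refine ⟨s, fun y => ?_⟩
    rw [← mem_neighborFinset, hs, Finset.mem_singleton]
  have hleafL : ∀ x s, LeafAt G x s → x ∈ L := by
    intro x s hs
    rw [hL, Finset.mem_filter]
    refine ⟨Finset.mem_univ _, Finset.card_eq_one.2 ⟨s, ?_⟩⟩
    ext y
    rw [mem_neighborFinset, hs, Finset.mem_singleton]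
  have hsub : ∀ x ∈ L, x = u ∨ x = v := by
    intro x hx
    obtain ⟨s, hs⟩ := hleaf0 x hx
    exact h.leaf_mem hc (by omega) hs
  have hsame : ∀ x ∈ L, ∀ y ∈ L, ∀ s, LeafAt G x s → LeafAt G y s → x = y := by
    intro x hx y hy s h1 h2
    rcases hsub x hx with rfl | rfl <;> rcases hsub y hy with rfl | rfl
    · rfl
    · exact (h.not_same hc (by omega) h1 h2).elim
    · exact (h.not_same hc (by omega) h2 h1).elim
    · rfl
  have hleaf1 : ∀ x ∈ L, ∀ s, LeafAt G x s → s ∉ L := by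
    intro x hx s hs hsL
    have hne : s ≠ x := ((hs s).2 rfl).ne'
    rcases hsub x hx with rfl | rfl
    · have h1 := (h.leaf_facts hc (by omega) hs).1
      rcases hsub s hsL with rfl | rfl
      · exact hne rfl
      · exact h.hv h1
    · have h1 := (h.symm.leaf_facts hc (by omega) hs).1
      rcases hsub s hsL with rfl | rfl
      · exact h.hu h1
      · exact hne rfl
  have hthree : ∀ x ∈ L, ∀ s, LeafAt G x s → 3 ≤ G.degree s := by
    intro x hx s hs
    by_contra hlt
    have hsL := hleaf1 x hx s hs
    have hp := hpos s
    have hd2 : G.degree s = 2 := by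
      have : G.degree s ≠ 1 := fun h1 => hsL (by rw [hL, Finset.mem_filter]; exact ⟨Finset.mem_univ _, h1⟩)
      omega
    obtain ⟨a, b, hab, hnb⟩ := Finset.card_eq_two.1 hd2
    have hadj : ∀ y, G.Adj s y ↔ y = a ∨ y = b := by
      intro y
      rw [← mem_neighborFinset, hnb]; simp
    have hxs := (hadj x).1 ((hs s).2 rfl).symm
    obtain ⟨z, hzs, hzx, hz⟩ : ∃ z, G.Adj s z ∧ z ≠ x ∧ ∀ y, G.Adj s y → y = x ∨ y = z := by
      rcases hxs with rfl | rfl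
      · exact ⟨b, (hadj b).2 (Or.inr rfl), hab.symm, fun y hy => (hadj y).1 hy⟩
      · exact ⟨a, (hadj a).2 (Or.inl rfl), hab, fun y hy => ((hadj y).1 hy).symm⟩
    rcases hsub x hx with rfl | rfl
    · exact h.not_two hc h6 hs hz hzs hzx
    · exact h.symm.not_two hc h6 hs hz hzs hzx
  -- counting
  have hsplit : ∀ x, G.degree x = ((G.neighborFinset x).filter (· ∈ L)).card +
      ((G.neighborFinset x).filter (· ∉ L)).card := by
    intro x
    rw [Finset.card_filter_add_card_filter_not]
    rfl
  have hle1 : ∀ x, ((G.neighborFinset x).filter (· ∈ L)).card ≤ 1 := by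
    intro x
    rw [Finset.card_le_one]
    intro a ha b hb
    rw [Finset.mem_filter, mem_neighborFinset] at ha hb
    obtain ⟨s, hs⟩ := hleaf0 a ha.2
    obtain ⟨t, ht⟩ := hleaf0 b hb.2
    have e1 := (hs x).1 ha.1.symm
    have e2 := (ht x).1 hb.1.symm
    subst e1
    subst e2
    exact hsame a ha.2 b hb.2 _ hs ht
  have hge2 : ∀ x, x ∉ L → 2 ≤ ((G.neighborFinset x).filter (· ∉ L)).card := by
    intro x hx
    have h1 := hsplit x
    have h2 := hle1 x
    by_cases h0 : ((G.neighborFinset x).filter (· ∈ L)).card = 0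
    · have := hpos x
      have : G.degree x ≠ 1 := fun h1 => hx (by rw [hL, Finset.mem_filter]; exact ⟨Finset.mem_univ _, h1⟩)
      omega
    · obtain ⟨l, hl⟩ := Finset.card_pos.1 (Nat.pos_of_ne_zero h0)
      rw [Finset.mem_filter, mem_neighborFinset] at hl
      obtain ⟨s, hs⟩ := hleaf0 l hl.2
      have e1 := (hs x).1 hl.1.symm
      subst e1
      have := hthree l hl.2 _ hs
      omega
  have hLL : ∀ x ∈ L, ((G.neighborFinset x).filter (· ∈ L)).card = 0 := by
    intro x hx
    rw [Finset.card_eq_zero, Finset.filter_eq_empty_iff]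
    intro y hy
    rw [mem_neighborFinset] at hy
    obtain ⟨s, hs⟩ := hleaf0 x hx
    rw [(hs y).1 hy]
    exact hleaf1 x hx s hs
  have hdouble : ∑ x, ((G.neighborFinset x).filter (· ∈ L)).card = L.card := by
    have e1 : ∑ x, ((G.neighborFinset x).filter (· ∈ L)).card =
        ∑ x ∈ L, G.degree x := by
      have := Finset.sum_card_bipartiteAbove_eq_sum_card_bipartiteBelow
        (s := (Finset.univ : Finset V)) (t := L) (fun x y => G.Adj x y)
      convert this using 2 with x _ x _
      · congr 1
        ext y
        simp [Finset.bipartiteAbove, and_comm]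
      · rw [← card_neighborFinset_eq_degree]
        congr 1
        ext y
        simp [Finset.bipartiteBelow, adj_comm]
    rw [e1, Finset.sum_congr rfl (fun x hx => (Finset.mem_filter.1 hx).2)]
    simp [hL]
  have hsum2 : ∑ x, ((G.neighborFinset x).filter (· ∉ L)).card + L.card = 2 * Fintype.card V := by
    rw [← hsum, Finset.sum_congr rfl (fun x _ => hsplit x), Finset.sum_add_distrib, hdouble, add_comm]
  have hsumg : ∑ x : V, (if x ∈ L then 1 else 2) + L.card = 2 * Fintype.card V := by
    have : ∀ x : V, (if x ∈ L then 1 else 2) + (if x ∈ L then 1 else 0) = 2 := by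
      intro x; split_ifs <;> rfl
    have e : L.card = ∑ x : V, (if x ∈ L then 1 else 0) := by simp
    rw [e, ← Finset.sum_add_distrib, Finset.sum_congr rfl (fun x _ => this x)]
    simp [mul_comm]
  have hpt : ∀ x ∈ (Finset.univ : Finset V), (if x ∈ L then 1 else 2) ≤
      ((G.neighborFinset x).filter (· ∉ L)).card := by
    intro x _
    split_ifs with hx
    · have h1 := hsplit x
      have h2 := hLL x hx
      have h3 := hpos x
      omega
    · exact hge2 x hx
  have heq := (Finset.sum_eq_sum_iff_of_le hpt).1 (by omega)
  refine ⟨(L : Set V), ?_, ?_, ?_, ?_⟩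
  · intro x hx
    simpa using hsub x hx
  · intro x hx
    obtain ⟨s, hs⟩ := hleaf0 x hx
    exact ⟨s, hleaf1 x hx s hs, hs⟩
  · intro x hx
    have hx' : x ∉ L := hx
    have h1 := heq x (Finset.mem_univ x)
    rw [if_neg hx'] at h1
    obtain ⟨a, b, _, hab⟩ := Finset.card_eq_two.1 h1.symm
    refine ⟨a, b, fun y hy hxy => ?_⟩
    have : y ∈ (G.neighborFinset x).filter (· ∉ L) := by
      rw [Finset.mem_filter, mem_neighborFinset]
      exact ⟨hxy, hy⟩
    rw [hab] at this
    simpa using this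
  · exact hsame

end asc
section mainpart

variable {V : Type*} [Fintype V] {G : SimpleGraph V} {u v : V}
variable {m : ℕ} {f : Fin m → V} {π : V → Fin m} {L : Set V}

lemma Cfg.case_empty (hc : G.Connected) (h : Cfg G m f π L) (hL : L ⊆ ∅) (ha : Asc G u v) :
    False := by
  have hm := h.hm
  have hnot : ∀ x, x ∉ L := fun x hx => hL hx
  have hecc : ∀ x, graphEcc G x = m / 2 := by
    intro x
    have hx := h.right_inv x (hnot x)
    apply le_antisymm
    · apply ecc_le
      intro y
      have hy := h.right_inv y (hnot y)
      rw [← hx, ← hy, h.dist_eq hc]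
      have := (π x).2
      have := (π y).2
      simp only [cd]
      omega
    · have hi := (π x).2
      obtain ⟨j, hj, hd⟩ : ∃ j, j < m ∧ cd m (π x) j = m / 2 := by
        by_cases hlt : (π x : ℕ) + m / 2 < m
        · exact ⟨π x + m / 2, hlt, by simp only [cd]; omega⟩
        · exact ⟨π x + m / 2 - m, by omega, by simp only [cd]; omega⟩
      have e1 := h.dist_eq hc (π x) ⟨j, hj⟩
      rw [hx] at e1
      have := dist_le_ecc (G := G) x (f ⟨j, hj⟩)
      simp only at e1
      omega
  have : Nonempty V := ⟨u⟩
  obtain ⟨x, hx⟩ := exists_ecc_eq_radius (G := G)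
  apply ha.hu
  rw [← hx, hecc, hecc]

lemma Cfg.leaf_dist (hc : G.Connected) (h : Cfg G m f π L) {l : V} (hl : l ∈ L) (i : Fin m) :
    G.dist l (f i) = cd m (π l) i + 1 := by
  rw [(h.leaf l hl).dist_eq hc (x := f i) (fun e => h.notMem i (by rw [e]; exact hl)), h.dist_eq hc]

lemma Cfg.inj (h : Cfg G m f π L) : Function.Injective f :=
  Function.LeftInverse.injective h.left_inv

lemma Cfg.case_one (hc : G.Connected) (h : Cfg G m f π L) (hL : L = {u}) (hπ : (π u).val = 0)
    (ha : Asc G u v) : Even m := by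
  by_contra hodd
  rw [Nat.not_even_iff] at hodd
  have hm := h.hm
  have huL : u ∈ L := by rw [hL]; rfl
  have hr : graphRadius G ≤ m / 2 := by
    refine (radius_le (f (π u))).trans (ecc_le fun y => ?_)
    by_cases hy : y ∈ L
    · rw [hL] at hy
      have : y = u := hy
      subst this
      rw [dist_comm, h.leaf_dist hc huL]
      simp only [cd]
      omega
    · rw [← h.right_inv y hy, h.dist_eq hc]
      have := (π y).2
      simp only [cd]
      omega
  have d1 := h.leaf_dist hc huL ⟨m / 2, by omega⟩
  have d2 := h.leaf_dist hc huL ⟨m / 2 + 1, by omega⟩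
  simp only [cd] at d1 d2
  have e1 := dist_le_ecc (G := G) u (f ⟨m / 2, by omega⟩)
  have e2 := dist_le_ecc (G := G) (f ⟨m / 2, by omega⟩) u
  have e3 := dist_le_ecc (G := G) (f ⟨m / 2 + 1, by omega⟩) u
  rw [dist_comm] at e2 e3
  have := ha.three (a := u) (b := f ⟨m / 2, by omega⟩) (c := f ⟨m / 2 + 1, by omega⟩)
    (fun e => h.notMem _ (e ▸ huL)) (fun e => h.notMem _ (e ▸ huL))
    (fun e => by have := h.inj e; simp at this) (by omega) (by omega)
  omega

open Classical in
lemma Cfg.case_two (hc : G.Connected) (h6 : 6 ≤ Fintype.card V) (h : Cfg G m f π L)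
    (hL : L = {u, v}) (hπ : (π u).val = 0) (ha : Asc G u v) : False := by
  have hm := h.hm
  have huL : u ∈ L := by rw [hL]; simp
  have hvL : v ∈ L := by rw [hL]; simp
  have hm4 : 4 ≤ m := by
    have hsub : (Finset.univ : Finset V) ⊆ Finset.univ.image f ∪ {u, v} := by
      intro x _
      rw [Finset.mem_union]
      by_cases hx : x ∈ L
      · right
        rw [hL] at hx
        simpa using hx
      · left
        rw [Finset.mem_image]
        exact ⟨π x, Finset.mem_univ _, h.right_inv x hx⟩
    have h1 := Finset.card_le_card hsub
    have h2 := Finset.card_union_le (Finset.univ.image f) ({u, v} : Finset V)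
    have h3 := Finset.card_image_le (s := Finset.univ) (f := f)
    have h4 := Finset.card_le_two (a := u) (b := v)
    rw [Finset.card_univ] at h1 h3
    rw [Fintype.card_fin] at h3
    omega
  obtain ⟨-, h2, h3⟩ := ha.leaf_facts hc (by omega) (h.leaf u huL)
  have h5 := (h.leaf v hvL).dist_eq hc ha.ne
  rw [dist_comm, h3, dist_comm, h.leaf_dist hc huL] at h5
  have hb := (π v).2
  have h7 := h.leaf_dist hc huL ⟨m / 2, by omega⟩
  have h8 := dist_le_ecc (G := G) (f ⟨m / 2, by omega⟩) u
  rw [dist_comm, ha.cen _ (fun e => h.notMem _ (by rw [e]; exact huL))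
    (fun e => h.notMem _ (by rw [e]; exact hvL))] at h8
  simp only [cd] at h5 h7
  obtain ⟨j, hj, hj1, hj2⟩ : ∃ j, j < m ∧ cd m (π u) j < m / 2 ∧ cd m (π v) j < m / 2 := by
    simp only [cd]
    by_cases hb2 : (π v).val = m / 2
    · exact ⟨1, by omega, by omega, by omega⟩
    · exact ⟨m - 1, by omega, by omega, by omega⟩
  have hfin : graphEcc G (f ⟨j, hj⟩) ≤ m / 2 := by
    apply ecc_le
    intro y
    by_cases hy : y ∈ L
    · rw [dist_comm, h.leaf_dist hc hy]
      rw [hL] at hy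
      rcases hy with rfl | hy
      · exact hj1
      · have : y = v := hy
        subst this
        exact hj2
    · rw [← h.right_inv y hy, h.dist_eq hc]
      have := (π y).2
      simp only [cd]
      omega
  have := radius_le (G := G) (f ⟨j, hj⟩)
  omega

lemma cpp_inl_inl (m : ℕ) (i j : Fin m) :
    (cyclePlusPendant m).Adj (Sum.inl i) (Sum.inl j) ↔ (cycleGraph m).Adj i j := by
  simp only [cyclePlusPendant, fromRel_adj]
  constructor
  · rintro ⟨_, h | h⟩
    · exact h
    · exact h.symm
  · intro h
    exact ⟨fun e => h.ne (Sum.inl_injective e), Or.inl h⟩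

lemma cpp_inl_inr (m : ℕ) (i : Fin m) (a : Unit) :
    (cyclePlusPendant m).Adj (Sum.inl i) (Sum.inr a) ↔ i.val = 0 := by
  simp [cyclePlusPendant, fromRel_adj]

lemma cpp_inr_inr (m : ℕ) (a b : Unit) :
    ¬ (cyclePlusPendant m).Adj (Sum.inr a) (Sum.inr b) := by
  simp [cyclePlusPendant, fromRel_adj]

lemma Cfg.iso (h : Cfg G m f π L) (hL : L = {u}) (hπ : (π u).val = 0) :
    Nonempty (G ≃g cyclePlusPendant m) ∧ Fintype.card V = m + 1 := by
  have hm := h.hm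
  have huL : u ∈ L := by rw [hL]; rfl
  have hbij : Function.Bijective (Sum.elim f (fun _ : Unit => u)) := by
    constructor
    · rintro (i | a) (j | b) hij
      · exact congrArg _ (h.inj hij)
      · exact (h.notMem i (by rw [show f i = u from hij]; exact huL)).elim
      · exact (h.notMem j (by rw [show f j = u from hij.symm]; exact huL)).elim
      · rfl
    · intro x
      by_cases hx : x ∈ L
      · rw [hL] at hx
        exact ⟨Sum.inr (), hx.symm⟩
      · exact ⟨Sum.inl (π x), h.right_inv x hx⟩
  have hlu : ∀ i : Fin m, G.Adj u (f i) ↔ i.val = 0 := by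
    intro i
    rw [h.leaf u huL]
    constructor
    · intro e
      rw [h.inj e, hπ]
    · intro e
      congr 1
      ext
      rw [e, hπ]
  constructor
  · refine ⟨RelIso.symm ⟨Equiv.ofBijective _ hbij, ?_⟩⟩
    rintro (i | a) (j | b)
    · rw [cpp_inl_inl, cycleGraph_adj_iff hm]
      exact h.adj i j
    · rw [cpp_inl_inr]
      exact (G.adj_comm _ _).trans (hlu i)
    · rw [(cyclePlusPendant m).adj_comm, cpp_inl_inr]
      exact hlu j
    · exact iff_of_false (G.irrefl (v := u)) (cpp_inr_inr m a b)
  · have := Fintype.card_of_bijective hbij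
    simp at this
    omega

lemma cfg_of_iso (hm : 3 ≤ m) (e : G ≃g cyclePlusPendant m) :
    ∃ (f : Fin m → V) (π : V → Fin m) (u : V), Cfg G m f π {u} ∧ (π u).val = 0 := by
  have hE : ∀ a b, G.Adj (e.symm a) (e.symm b) ↔ (cyclePlusPendant m).Adj a b :=
    fun a b => e.symm.map_adj_iff
  refine ⟨fun i => e.symm (Sum.inl i), fun x => Sum.elim id (fun _ => ⟨0, by omega⟩) (e x),
    e.symm (Sum.inr ()), ⟨hm, ?_, ?_, ?_, ?_, ?_⟩, ?_⟩
  · intro i; simp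
  · intro x hx
    rcases hx' : e x with i | a
    · have : x = e.symm (Sum.inl i) := by rw [← hx']; simp
      rw [this]; simp
    · exfalso
      apply hx
      have : x = e.symm (Sum.inr a) := by rw [← hx']; simp
      exact this
  · intro i j
    rw [hE, cpp_inl_inl, cycleGraph_adj_iff hm]
  · intro x hx y
    have hx' : x = e.symm (Sum.inr ()) := hx
    subst hx'
    obtain ⟨b, rfl⟩ := e.symm.surjective y
    rw [hE]
    simp only [RelIso.apply_symm_apply, Sum.elim_inr, EmbeddingLike.apply_eq_iff_eq]
    rcases b with j | b
    · rw [adj_comm, cpp_inl_inr]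
      simp [Fin.ext_iff]
    · simp [cpp_inr_inr]
  · intro i hi
    have := e.symm.injective (show e.symm (Sum.inl i) = e.symm (Sum.inr ()) from hi)
    cases this
  · simp

lemma Cfg.asc (hc : G.Connected) (h : Cfg G m f π {u}) (hπ : (π u).val = 0) (hev : Even m) :
    IsAlmostSelfCentered G := by
  classical
  have hm := h.hm
  obtain ⟨k, hk⟩ := hev
  have huL : u ∈ ({u} : Set V) := rfl
  have hkm : k < m := by omega
  have hfu : ∀ i, f i ≠ u := fun i e => h.notMem i e
  have hrep : ∀ y, y ≠ u → ∃ i, f i = y := fun y hy => ⟨π y, h.right_inv y hy⟩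
  have hlow : ∀ i : Fin m, k ≤ graphEcc G (f i) := by
    intro i
    have hi := i.2
    obtain ⟨j, hj, hd⟩ : ∃ j, j < m ∧ cd m i j = k := by
      by_cases hlt : (i : ℕ) + k < m
      · exact ⟨i + k, hlt, by simp only [cd]; omega⟩
      · exact ⟨i + k - m, by omega, by simp only [cd]; omega⟩
    have e1 := h.dist_eq hc i ⟨j, hj⟩
    have := dist_le_ecc (G := G) (f i) (f ⟨j, hj⟩)
    simp only at e1
    omega
  have hup : ∀ i : Fin m, i.val ≠ k → graphEcc G (f i) ≤ k := by
    intro i hik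
    have hi := i.2
    apply ecc_le
    intro y
    by_cases hy : y = u
    · subst hy
      rw [dist_comm, h.leaf_dist hc huL]
      simp only [cd]
      omega
    · obtain ⟨j, rfl⟩ := hrep y hy
      rw [h.dist_eq hc]
      simp only [cd]
      omega
  have hd := h.leaf_dist hc huL ⟨k, hkm⟩
  have hd' : G.dist u (f ⟨k, hkm⟩) = k + 1 := by
    rw [hd]
    simp only [cd]
    omega
  have hu : k + 1 ≤ graphEcc G u := hd' ▸ dist_le_ecc u _
  have hfk : k + 1 ≤ graphEcc G (f ⟨k, hkm⟩) := by
    rw [← hd', dist_comm]; exact dist_le_ecc _ _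
  have hr : graphRadius G = k := by
    apply le_antisymm
    · exact (radius_le (f ⟨0, by omega⟩)).trans (hup _ (by simp; omega))
    · have : Nonempty V := ⟨u⟩
      obtain ⟨x, hx⟩ := exists_ecc_eq_radius (G := G)
      rw [← hx]
      by_cases hxu : x = u
      · subst hxu; omega
      · obtain ⟨i, rfl⟩ := hrep x hxu
        exact hlow i
  refine ⟨hc, ?_⟩
  have hset : {v : V | graphEcc G v = graphRadius G} = ({u, f ⟨k, hkm⟩} : Set V)ᶜ := by
    ext x
    simp only [Set.mem_ofPred_eq, Set.mem_compl_iff, Set.mem_insert_iff, Set.mem_singleton_iff, hr]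
    by_cases hxu : x = u
    · subst hxu
      simp; omega
    · obtain ⟨i, rfl⟩ := hrep x hxu
      by_cases hik : i.val = k
      · have : i = ⟨k, hkm⟩ := Fin.ext hik
        subst this
        simp; omega
      · have h1 := hlow i
        have h2 := hup i hik
        have : f i ≠ f ⟨k, hkm⟩ := fun e => hik (congrArg Fin.val (h.inj e))
        simp [hxu, this]; omega
  rw [hset, Nat.card_coe_set_eq]
  have := Set.ncard_add_ncard_compl ({u, f ⟨k, hkm⟩} : Set V)
  rw [Set.ncard_pair (hfu _).symm, Nat.card_eq_fintype_card] at this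
  omega

lemma forward_one (hc : G.Connected) {c : V} (w : G.Walk c c) (hw : w.IsCycle)
    (ha : Asc G u v) (hL : L = {u}) (h2 : ∀ u ∈ L, ∃ s, s ∉ L ∧ LeafAt G u s)
    (h3 : ∀ x, x ∉ L → ∃ a b, ∀ y, y ∉ L → G.Adj x y → y = a ∨ y = b) :
    ∃ m, Even m ∧ Fintype.card V = m + 1 ∧ Nonempty (G ≃g cyclePlusPendant m) := by
  have huL : u ∈ L := by rw [hL]; rfl
  obtain ⟨s, hs, hls⟩ := h2 u huL
  obtain ⟨m, f, π, h, h0⟩ := exists_cfg_at hc w hw L h2 h3 s hs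
  have hπ : (π u).val = 0 := by
    have e := (hls _).1 ((h.leaf u huL _).2 rfl)
    rw [← e, h.left_inv] at h0
    exact h0
  have := h.iso hL hπ
  exact ⟨m, h.case_one hc hL hπ ha, this.2, this.1⟩

end mainpart

theorem unicyclic_almostSelfCentered_iff {V : Type*} [Fintype V] (G : SimpleGraph V)
    (n : ℕ) (hn : Fintype.card V = n) (h6 : 6 ≤ n) (hG : Unicyclic G) :
    IsAlmostSelfCentered G ↔ Odd n ∧ Nonempty (G ≃g cyclePlusPendant (n - 1)) := by
  classical
  subst hn
  constructor
  · intro hasc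
    have hc := hG.1
    obtain ⟨u, v, ha⟩ := exists_asc (by omega) hasc
    obtain ⟨L, h1, h2, h3, -⟩ := ha.struct_facts hc h6 (sum_degree_of_unicyclic hG)
    obtain ⟨-, _, ⟨c, w, hw, -⟩, -⟩ := hG
    suffices hmain : ∃ m, Even m ∧ Fintype.card V = m + 1 ∧
        Nonempty (G ≃g cyclePlusPendant m) by
      obtain ⟨m, hm, hcard, hiso⟩ := hmain
      rw [hcard]
      exact ⟨hm.add_one, hiso⟩
    by_cases hu : u ∈ L <;> by_cases hv : v ∈ L
    · exfalso
      have hL : L = {u, v} := Set.Subset.antisymm h1 (by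
        rintro x (rfl | hx)
        · exact hu
        · rw [show x = v from hx]; exact hv)
      obtain ⟨s, hs, hls⟩ := h2 u hu
      obtain ⟨m, f, π, h, h0⟩ := exists_cfg_at hc w hw L h2 h3 s hs
      have hπ : (π u).val = 0 := by
        have e := (hls _).1 ((h.leaf u hu _).2 rfl)
        rw [← e, h.left_inv] at h0
        exact h0
      exact h.case_two hc h6 hL hπ ha
    · refine forward_one hc w hw ha (Set.Subset.antisymm ?_ (by simpa using hu)) h2 h3
      intro x hx
      rcases h1 hx with h | h
      · exact h
      · exact absurd (show x = v from h) (fun e => hv (e ▸ hx))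
    · refine forward_one hc w hw ha.symm (Set.Subset.antisymm ?_ (by simpa using hv)) h2 h3
      intro x hx
      rcases h1 hx with h | h
      · exact absurd h (fun e => hu (e ▸ hx))
      · exact h
    · exfalso
      obtain ⟨m, f, π, h, -⟩ := exists_cfg hc w hw L h2 h3
      refine h.case_empty hc ?_ ha
      intro x hx
      rcases h1 hx with h | h
      · exact absurd h (fun e => hu (e ▸ hx))
      · exact absurd (show x = v from h) (fun e => hv (e ▸ hx))
  · rintro ⟨hodd, ⟨e⟩⟩
    obtain ⟨f, π, u, h, h0⟩ := cfg_of_iso (by omega) e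
    exact h.asc hG.1 h0 (by
      obtain ⟨k, hk⟩ := hodd
      exact ⟨k, by omega⟩)
end

section
/- Let G be a connected graph of order n whose number of edges is n+1 and whose minimum degree is 2. If G is almost self-centered, then n is even and G is isomorphic to the theta graph θ_{1,2,n−2}, i.e., the graph obtained from the cycle C_{n−1} by adding one new vertex joined to two adjacent vertices of the cycle. -/
open SimpleGraph

/-- The theta graph `θ_{1,2,m-1}` realised as the graph obtained from the cycle `C_m`
by adding one new vertex joined to two adjacent vertices of the cycle. -/
def thetaOneTwo (m : ℕ) : SimpleGraph (Fin m ⊕ Unit) :=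
  SimpleGraph.fromRel fun a b =>
    match a, b with
    | Sum.inl i, Sum.inl j => (SimpleGraph.cycleGraph m).Adj i j
    | Sum.inl i, Sum.inr _ => (i : ℕ) = 0 ∨ (i : ℕ) = 1
    | _, _ => False

/-- The minimum degree of a graph. -/
noncomputable def graphMinDeg {V : Type*} [Fintype V] (G : SimpleGraph V) : ℕ :=
  sInf (Set.range fun v => (G.neighborSet v).ncard)

/-- A vertex at positive distance from `c` has a neighbour closer to `c`. -/
lemma exists_closer {W : Type*} {T : SimpleGraph W} (hT : T.Connected) (c v : W) (h : c ≠ v) :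
    ∃ u, T.Adj v u ∧ T.dist c u + 1 = T.dist c v := by
  obtain ⟨p, hp⟩ := hT.exists_walk_length_eq_dist v c
  cases p with
  | nil => exact absurd rfl h
  | @cons _ u _ hadj q =>
    refine ⟨u, hadj, ?_⟩
    have h1 := dist_le q
    have h2 : T.dist v c ≤ T.dist v u + T.dist u c := hT.dist_triangle
    have h3 := dist_eq_one_iff_adj.mpr hadj
    rw [Walk.length_cons] at hp
    rw [SimpleGraph.dist_comm (u := c) (v := u), SimpleGraph.dist_comm (u := c) (v := v)]
    omega

lemma closer_unique {W : Type*} {T : SimpleGraph W} (hT : T.IsTree) (c : W) {v u w : W}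
    (hu : T.Adj v u) (hw : T.Adj v w) (hdu : T.dist c u + 1 = T.dist c v)
    (hdw : T.dist c w + 1 = T.dist c v) : u = w := by
  obtain ⟨p, hp⟩ := hT.connected.exists_walk_length_eq_dist u c
  obtain ⟨q, hq⟩ := hT.connected.exists_walk_length_eq_dist w c
  have h1 : (Walk.cons hu p).IsPath := Walk.isPath_of_length_eq_dist _ (by
    rw [Walk.length_cons, hp, SimpleGraph.dist_comm, hdu, SimpleGraph.dist_comm])
  have h2 : (Walk.cons hw q).IsPath := Walk.isPath_of_length_eq_dist _ (by
    rw [Walk.length_cons, hq, SimpleGraph.dist_comm, hdw, SimpleGraph.dist_comm])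
  have h3 := (hT.isAcyclic.subsingleton_path v c).elim ⟨_, h1⟩ ⟨_, h2⟩
  have h4 : Walk.cons hu p = Walk.cons hw q := congrArg Subtype.val h3
  have h5 := congrArg Walk.snd h4
  simpa using h5

lemma tree_step {W : Type*} {T : SimpleGraph W} (hT : T.IsTree) (c : W) {u v : W}
    (h : T.Adj u v) : T.dist c u = T.dist c v + 1 ∨ T.dist c v = T.dist c u + 1 :=
  hT.dist_eq_dist_add_one_of_adj c h

lemma tree_median {W : Type*} {T : SimpleGraph W} (hT : T.IsTree) (a c : W) (k : ℕ) :
    ∀ b, T.dist a b = k → ∃ m, T.dist a m + T.dist b m = T.dist a b ∧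
      T.dist a m + T.dist c m = T.dist a c ∧ T.dist b m + T.dist c m = T.dist b c := by
  have tri := fun u v w => hT.connected.dist_triangle (u := u) (v := v) (w := w)
  have comm := fun u v => SimpleGraph.dist_comm (G := T) (u := u) (v := v)
  induction k with
  | zero =>
    intro b hb
    have : a = b := hT.connected.dist_eq_zero_iff.mp hb
    subst this
    exact ⟨a, by simp, by simp [comm], by simp [comm]⟩
  | succ k ih =>
    intro b hb
    have hab : a ≠ b := by rintro rfl; simp at hb
    obtain ⟨b', hbb, hd⟩ := exists_closer hT.connected a b hab
    obtain ⟨m, h1, h2, h3⟩ := ih b' (by omega)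
    have e1 := dist_eq_one_iff_adj.mpr hbb
    rcases tree_step hT c hbb with h | h
    · refine ⟨m, ?_, h2, ?_⟩
      · have := tri b b' m; have := tri a m b; have := comm m b; omega
      · have := tri b b' m; have := tri b m c; have := comm m c
        have := comm c b; have := comm c b'; omega
    · have hm : m = b' := by
        by_contra hne
        obtain ⟨w, hw, hwd⟩ := exists_closer hT.connected m b' hne
        have e2 := dist_eq_one_iff_adj.mpr hw
        have c1 : T.dist c w + 1 = T.dist c b' := by
          have := tri c m w; have := tri c w b'; have := comm w b'
          have := comm c b'; have := comm b' m; omega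
        have c2 : T.dist a w + 1 = T.dist a b' := by
          have := tri a m w; have := tri a w b'; have := comm w b'
          have := comm b' m; omega
        have := closer_unique hT c hw hbb.symm c1 (by omega)
        subst this
        omega
      subst hm
      refine ⟨b, by simp, ?_, by simp [comm]⟩
      have := comm c b; have := comm c m; omega

lemma tree_split {W : Type*} {T : SimpleGraph W} (hT : T.IsTree) (a b c P : W)
    (h : T.dist a P + T.dist b P = T.dist a b) :
    T.dist a P + T.dist c P = T.dist a c ∨ T.dist b P + T.dist c P = T.dist b c := by
  have tri := fun u v w => hT.connected.dist_triangle (u := u) (v := v) (w := w)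
  have comm := fun u v => SimpleGraph.dist_comm (G := T) (u := u) (v := v)
  obtain ⟨m, h1, h2, h3⟩ := tree_median hT a c _ P rfl
  obtain ⟨m', g1, g2, g3⟩ := tree_median hT b c _ P rfl
  by_cases hm : m = P
  · subst hm; left; omega
  by_cases hm' : m' = P
  · subst hm'; right; omega
  exfalso
  obtain ⟨u, hu, hud⟩ := exists_closer hT.connected m P hm
  obtain ⟨u', hu', hud'⟩ := exists_closer hT.connected m' P hm'
  have e1 := dist_eq_one_iff_adj.mpr hu
  have e1' := dist_eq_one_iff_adj.mpr hu'
  have c1 : T.dist c u + 1 = T.dist c P := by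
    have := tri c m u; have := tri c u P; have := comm u P; have := comm P m
    have := comm c P; omega
  have c1' : T.dist c u' + 1 = T.dist c P := by
    have := tri c m' u'; have := tri c u' P; have := comm u' P; have := comm P m'
    have := comm c P; omega
  have := closer_unique hT c hu hu' c1 c1'
  subst this
  have c2 : T.dist a u + 1 = T.dist a P := by
    have := tri a m u; have := tri a u P; have := comm u P; have := comm P m; omega
  have c3 : T.dist b u + 1 = T.dist b P := by
    have := tri b m' u; have := tri b u P; have := comm u P; have := comm P m'; omega
  have := tri a u b; have := comm u b; omega

/-- Vertices between `a` and `b` are determined by the distance to `a`. -/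
lemma between_inj {W : Type*} {T : SimpleGraph W} (hT : T.IsTree) (a b : W) (k : ℕ) :
    ∀ z z', T.dist b z = k → T.dist a z + T.dist b z = T.dist a b →
      T.dist a z' + T.dist b z' = T.dist a b → T.dist a z = T.dist a z' → z = z' := by
  have tri := fun u v w => hT.connected.dist_triangle (u := u) (v := v) (w := w)
  have comm := fun u v => SimpleGraph.dist_comm (G := T) (u := u) (v := v)
  induction k with
  | zero =>
    intro z z' h0 h1 h2 h3
    have e1 : b = z := hT.connected.dist_eq_zero_iff.mp h0
    have e2 : b = z' := hT.connected.dist_eq_zero_iff.mp (by omega)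
    exact e1.symm.trans e2
  | succ k ih =>
    intro z z' h0 h1 h2 h3
    have n1 : b ≠ z := by rintro rfl; simp at h0
    have n2 : b ≠ z' := by
      rintro rfl; simp at h2; omega
    obtain ⟨w, hw, hwd⟩ := exists_closer hT.connected b z n1
    obtain ⟨w', hw', hwd'⟩ := exists_closer hT.connected b z' n2
    have e1 := dist_eq_one_iff_adj.mpr hw
    have e1' := dist_eq_one_iff_adj.mpr hw'
    have a1 : T.dist a w = T.dist a z + 1 := by
      have := tri a z w; have := tri a w b; have := comm w b; omega
    have a2 : T.dist a w' = T.dist a z' + 1 := by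
      have := tri a z' w'; have := tri a w' b; have := comm w' b; omega
    have := ih w w' (by omega) (by omega) (by omega) (by omega)
    subst this
    exact closer_unique hT a hw.symm hw'.symm (by omega) (by omega)

/-- If every vertex outside `L` has two neighbours, then every vertex is on a geodesic from `P`
to some vertex of `L`. -/
lemma tree_extend {W : Type*} [Finite W] {T : SimpleGraph W} (hT : T.IsTree) (L : Set W)
    (hL : ∀ z, z ∉ L → ∃ u v, u ≠ v ∧ T.Adj z u ∧ T.Adj z v) (P z : W) :
    ∃ l ∈ L, T.dist P z + T.dist z l = T.dist P l := by
  have tri := fun u v w => hT.connected.dist_triangle (u := u) (v := v) (w := w)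
  let A : Set W := {u | T.dist P z + T.dist z u = T.dist P u}
  have hA : A.Nonempty := ⟨z, by simp [A]⟩
  obtain ⟨u, hu, hmax⟩ := Set.exists_max_image A (fun u => T.dist P u) A.toFinite hA
  by_cases huL : u ∈ L
  · exact ⟨u, huL, hu⟩
  exfalso
  obtain ⟨v, w, hvw, hv, hw⟩ := hL u huL
  have key : ∀ t, T.Adj u t → T.dist P t + 1 = T.dist P u := by
    intro t ht
    rcases tree_step hT P ht with h | h
    · exact h.symm
    · exfalso
      have e1 := dist_eq_one_iff_adj.mpr ht
      have htA : t ∈ A := by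
        have h1 := tri z u t; have h2 := tri P z t
        change T.dist P z + T.dist z u = T.dist P u at hu
        change T.dist P z + T.dist z t = T.dist P t
        omega
      have := hmax t htA
      omega
  exact hvw (closer_unique hT P hv hw (key v hv) (key w hw))

lemma cycle_adj_iff (m : ℕ) (hm : 3 ≤ m) (i j : Fin m) : (SimpleGraph.cycleGraph m).Adj i j ↔
    ((i : ℕ) + 1 = j ∨ (j : ℕ) + 1 = i ∨ ((i : ℕ) = 0 ∧ (j : ℕ) + 1 = m) ∨
      ((j : ℕ) = 0 ∧ (i : ℕ) + 1 = m)) := by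
  have key : ∀ a b : Fin m, ((a - b : Fin m) : ℕ) = 1 ↔
      ((b : ℕ) + 1 = a ∨ ((a : ℕ) = 0 ∧ (b : ℕ) + 1 = m)) := by
    intro a b
    have ha := a.2
    have hb := b.2
    rw [Fin.sub_def]
    simp only
    rcases le_or_gt (b : ℕ) a with h | h
    · have : m - (b : ℕ) + a = m + (a - b) := by omega
      rw [this, Nat.add_mod_left, Nat.mod_eq_of_lt (by omega)]
      omega
    · rw [Nat.mod_eq_of_lt (by omega)]
      omega
  rw [SimpleGraph.cycleGraph_adj', key, key]
  tauto

lemma theta_inl_inl (m : ℕ) (i j : Fin m) :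
    (thetaOneTwo m).Adj (Sum.inl i) (Sum.inl j) ↔ (SimpleGraph.cycleGraph m).Adj i j := by
  simp only [thetaOneTwo, SimpleGraph.fromRel_adj]
  constructor
  · rintro ⟨_, h | h⟩
    · exact h
    · exact h.symm
  · intro h
    exact ⟨fun e => h.ne (Sum.inl_injective e), Or.inl h⟩

lemma theta_inl_inr (m : ℕ) (i : Fin m) (u : Unit) :
    (thetaOneTwo m).Adj (Sum.inl i) (Sum.inr u) ↔ (i : ℕ) = 0 ∨ (i : ℕ) = 1 := by
  simp [thetaOneTwo, SimpleGraph.fromRel_adj]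

lemma iso_of_labelling {V : Type*} [Fintype V] (G : SimpleGraph V) (x : V) (r : ℕ) (hr : 1 ≤ r)
    (k : V → ℕ) (h1 : ∀ v, v ≠ x → k v ≤ 2 * r)
    (h2 : ∀ u v, u ≠ x → v ≠ x → k u = k v → u = v)
    (h3 : ∀ j, j ≤ 2 * r → ∃ v, v ≠ x ∧ k v = j)
    (h4 : ∀ u v, u ≠ x → v ≠ x → (G.Adj u v ↔ (k u + 1 = k v ∨ k v + 1 = k u ∨
      (k u = 0 ∧ k v = 2 * r) ∨ (k v = 0 ∧ k u = 2 * r))))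
    (h5 : ∀ v, v ≠ x → (G.Adj v x ↔ k v + 1 = r ∨ k v = r)) :
    Fintype.card V = 2 * r + 2 ∧ Nonempty (G ≃g thetaOneTwo (2 * r + 1)) := by
  classical
  let pos : ℕ → ℕ := fun k => if k ≤ r then r - k else 3 * r + 1 - k
  have hpos : ∀ j, j ≤ 2 * r → pos j < 2 * r + 1 := by
    intro j hj; simp only [pos]; split_ifs <;> omega
  let g : V → Fin (2 * r + 1) ⊕ Unit := fun v =>
    if h : v = x then Sum.inr () else Sum.inl ⟨pos (k v), hpos _ (h1 v h)⟩
  have gx : g x = Sum.inr () := by simp [g]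
  have gv : ∀ v (h : v ≠ x), g v = Sum.inl ⟨pos (k v), hpos _ (h1 v h)⟩ := by
    intro v h; simp [g, h]
  have hinj : Function.Injective g := by
    intro u v huv
    by_cases hu : u = x <;> by_cases hv : v = x
    · rw [hu, hv]
    · rw [hu, gx, gv v hv] at huv; cases huv
    · rw [hv, gx, gv u hu] at huv; cases huv
    · rw [gv u hu, gv v hv] at huv
      have e := congrArg Fin.val (Sum.inl_injective huv)
      simp only [pos] at e
      have := h1 u hu; have := h1 v hv
      apply h2 u v hu hv
      split_ifs at e <;> omega
  have hsurj : Function.Surjective g := by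
    rintro (i | u)
    · obtain ⟨v, hv, hk⟩ := h3 (pos i) (by have := hpos i (by omega); omega)
      refine ⟨v, ?_⟩
      rw [gv v hv]
      congr 1
      apply Fin.ext
      have := i.2
      simp only [hk, pos]
      split_ifs <;> omega
    · exact ⟨x, gx⟩
  let e : V ≃ Fin (2 * r + 1) ⊕ Unit := Equiv.ofBijective g ⟨hinj, hsurj⟩
  refine ⟨by rw [Fintype.card_congr e]; simp, ⟨⟨e, ?_⟩⟩⟩
  have key5 : ∀ v, v ≠ x → ((thetaOneTwo (2 * r + 1)).Adj (g v) (g x) ↔ G.Adj v x) := by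
    intro v hv
    rw [gx, gv v hv, theta_inl_inr, h5 v hv]
    have := h1 v hv
    simp only [pos]
    split_ifs <;> omega
  intro u v
  change (thetaOneTwo (2 * r + 1)).Adj (g u) (g v) ↔ G.Adj u v
  by_cases hu : u = x <;> by_cases hv : v = x
  · rw [hu, hv]; simp
  · rw [hu, SimpleGraph.adj_comm, key5 v hv, SimpleGraph.adj_comm]
  · rw [hv, key5 u hu]
  · rw [gv u hu, gv v hv, theta_inl_inl, cycle_adj_iff _ (by omega), h4 u v hu hv]
    have := h1 u hu; have := h1 v hv
    simp only [pos]
    split_ifs <;> omega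

lemma final_case {V : Type*} [Fintype V] (G : SimpleGraph V) (S : Set V) (x y : V)
    (hS : ∀ v, v ∈ S ↔ v ≠ x ∧ v ≠ y) (hne : x ≠ y) (hnadj : ¬ G.Adj x y)
    (x1 x2 y1 y2 : S) (hx : ∀ v, G.Adj x v ↔ v = x1 ∨ v = x2)
    (hy : ∀ v, G.Adj y v ↔ v = y1 ∨ v = y2)
    (hT : (G.induce S).IsTree)
    (hL : ∀ P z, ∃ l ∈ ({x1, x2, y1, y2} : Set S),
      (G.induce S).dist P z + (G.induce S).dist z l = (G.induce S).dist P l)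
    (ρ : ℕ) (h11 : (G.induce S).dist x1 y1 = ρ) (h22 : (G.induce S).dist x2 y2 = ρ)
    (h12 : (G.induce S).dist x1 y2 = ρ + 1) (h21 : (G.induce S).dist x2 y1 = ρ + 1)
    (hadj : (G.induce S).Adj x1 x2) :
    ∃ r, Fintype.card V = 2 * r + 2 ∧ Nonempty (G ≃g thetaOneTwo (2 * r + 1)) := by
  classical
  refine ⟨ρ + 1, ?_⟩
  set T := G.induce S with hTdef
  have tri := fun u v w => hT.connected.dist_triangle (u := u) (v := v) (w := w)
  have comm := fun u v => SimpleGraph.dist_comm (G := T) (u := u) (v := v)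
  have e12 := dist_eq_one_iff_adj.mpr hadj
  have hyy : T.dist y1 y2 = 2 * ρ + 1 := by
    have := comm x1 x2; have := comm x1 y1; have := comm x2 y1; have := comm x1 y2
    have := comm x2 y2
    rcases tree_split hT x2 y1 y2 x1 (by omega) with h | h <;> omega
  have hbet : ∀ z, T.dist y1 z + T.dist y2 z = T.dist y1 y2 := by
    intro z
    have t0 := tri y1 z y2
    have := comm z y1; have := comm z y2; have := comm z x1
    have := comm x1 x2; have := comm x1 y1; have := comm x2 y1; have := comm x1 y2
    have := comm x2 y2
    obtain ⟨l, hl, hd⟩ := hL x1 z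
    simp only [Set.mem_insert_iff, Set.mem_singleton_iff] at hl
    rcases hl with rfl | rfl | rfl | rfl
    · simp only [SimpleGraph.dist_self] at hd
      have hz : l = z := hT.connected.dist_eq_zero_iff.mp (by omega)
      subst hz; omega
    · have := tri y1 x1 z; have := tri z l y2; omega
    · have := tri z x1 y2; omega
    · have := tri y1 x1 z; omega
  have hSx : x ∉ S := fun h => ((hS x).mp h).1 rfl
  have hSy : y ∉ S := fun h => ((hS y).mp h).2 rfl
  let k : V → ℕ := fun v => if h : v ∈ S then T.dist y1 ⟨v, h⟩ else 2 * (ρ + 1)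
  have ky : k y = 2 * (ρ + 1) := by simp [k, hSy]
  have kS : ∀ z : S, k z = T.dist y1 z := by intro z; simp [k]
  have kle : ∀ z : S, k z ≤ 2 * ρ + 1 := by intro z; rw [kS]; have := hbet z; omega
  have kinj : ∀ z w : S, k z = k w → z = w := by
    intro z w h
    rw [kS, kS] at h
    exact between_inj hT y1 y2 _ z w rfl (hbet z) (hbet w) h
  have hcase : ∀ v, v ≠ x → v = y ∨ ∃ z : S, v = z := by
    intro v hv
    by_cases h : v = y
    · exact Or.inl h
    · exact Or.inr ⟨⟨v, (hS v).mpr ⟨hv, h⟩⟩, rfl⟩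
  have k11 : k y1 = 0 := by rw [kS]; simp
  have k12 : k y2 = 2 * ρ + 1 := by rw [kS, hyy]
  have kx1 : k x1 = ρ := by rw [kS, comm, h11]
  have kx2 : k x2 = ρ + 1 := by rw [kS, comm, h21]
  have hyk : ∀ z : S, G.Adj y z ↔ k z = 0 ∨ k z = 2 * ρ + 1 := by
    intro z
    rw [hy]
    constructor
    · rintro (h | h)
      · left; rw [h, k11]
      · right; rw [h, k12]
    · rintro (h | h)
      · left; rw [kinj z y1 (by omega)]
      · right; rw [kinj z y2 (by omega)]
  have hxk : ∀ z : S, G.Adj x z ↔ k z = ρ ∨ k z = ρ + 1 := by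
    intro z
    rw [hx]
    constructor
    · rintro (h | h)
      · left; rw [h, kx1]
      · right; rw [h, kx2]
    · rintro (h | h)
      · left; rw [kinj z x1 (by omega)]
      · right; rw [kinj z x2 (by omega)]
  have hconsec : ∀ z w : S, k z + 1 = k w → G.Adj z w := by
    intro z w h
    have hyw : y1 ≠ w := by
      rintro rfl; omega
    obtain ⟨u, hu, hud⟩ := exists_closer hT.connected y1 w hyw
    have : u = z := kinj u z (by have := kS u; have := kS w; omega)
    subst this
    exact hu.symm
  have hdown : ∀ d, d ≤ 2 * ρ + 1 → ∃ z : S, k z + d = 2 * ρ + 1 := by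
    intro d
    induction d with
    | zero => intro _; exact ⟨y2, by omega⟩
    | succ d ih =>
      intro hd
      obtain ⟨w, hw⟩ := ih (by omega)
      have hyw : y1 ≠ w := by
        rintro rfl; omega
      obtain ⟨u, hu, hud⟩ := exists_closer hT.connected y1 w hyw
      refine ⟨u, ?_⟩
      rw [kS u]; rw [kS w] at hw; omega
  apply iso_of_labelling G x (ρ + 1) (by omega) k
  · intro v hv
    rcases hcase v hv with rfl | ⟨z, rfl⟩
    · omega
    · have := kle z; omega
  · intro u v hu hv h
    rcases hcase u hu with rfl | ⟨z, rfl⟩ <;> rcases hcase v hv with rfl | ⟨w, rfl⟩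
    · rfl
    · have := kle w; omega
    · have := kle z; omega
    · rw [kinj z w h]
  · intro j hj
    rcases Nat.lt_or_ge (2 * ρ + 1) j with h | h
    · exact ⟨y, hne.symm, by omega⟩
    · obtain ⟨z, hz⟩ := hdown (2 * ρ + 1 - j) (by omega)
      exact ⟨z, ((hS z).mp z.2).1, by omega⟩
  · intro u v hu hv
    rcases hcase u hu with rfl | ⟨z, rfl⟩ <;> rcases hcase v hv with rfl | ⟨w, rfl⟩
    · constructor
      · intro h; exact absurd h (G.loopless.irrefl _)
      · intro h; omega
    · rw [hyk w]; have := kle w; omega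
    · rw [SimpleGraph.adj_comm, hyk z]; have := kle z; omega
    · have := kle z; have := kle w
      constructor
      · intro h
        have h' : T.Adj z w := h
        have := tree_step hT y1 h'
        rw [kS z, kS w]; omega
      · rintro (h | h | h | h)
        · exact hconsec z w h
        · exact (hconsec w z h).symm
        · omega
        · omega
  · intro v hv
    rcases hcase v hv with rfl | ⟨z, rfl⟩
    · constructor
      · intro h; exact absurd h.symm hnadj
      · intro h; omega
    · rw [SimpleGraph.adj_comm, hxk z]; omega

lemma induce_dist_le {V : Type*} (G : SimpleGraph V) (S : Set V) (hT : (G.induce S).Connected)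
    (a b : S) : G.dist a b ≤ (G.induce S).dist a b := by
  obtain ⟨p, hp⟩ := hT.exists_walk_length_eq_dist a b
  rw [← hp, ← Walk.length_map (Embedding.induce S).toHom p]
  exact dist_le _

lemma middle_case {V : Type*} [Fintype V] (G : SimpleGraph V) (hG : G.Connected)
    (S : Set V) (x y : V)
    (hS : ∀ v, v ∈ S ↔ v ≠ x ∧ v ≠ y) (hne : x ≠ y) (hnadj : ¬ G.Adj x y)
    (x1 x2 y1 y2 : S) (hx : ∀ v, G.Adj x v ↔ v = x1 ∨ v = x2)
    (hy : ∀ v, G.Adj y v ↔ v = y1 ∨ v = y2) (hx12 : x1 ≠ x2) (hy12 : y1 ≠ y2)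
    (hT : (G.induce S).IsTree)
    (hL : ∀ P z, ∃ l ∈ ({x1, x2, y1, y2} : Set S),
      (G.induce S).dist P z + (G.induce S).dist z l = (G.induce S).dist P l)
    (ρ : ℕ) (h11 : (G.induce S).dist x1 y1 = ρ) (h22 : (G.induce S).dist x2 y2 = ρ)
    (h12 : (G.induce S).dist x1 y2 = ρ ∨ (G.induce S).dist x1 y2 = ρ + 1)
    (h21 : (G.induce S).dist x2 y1 = ρ ∨ (G.induce S).dist x2 y1 = ρ + 1)
    (hecc : ∀ P : S, ∃ v, ρ + 1 ≤ G.dist P v) :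
    ∃ r, Fintype.card V = 2 * r + 2 ∧ Nonempty (G ≃g thetaOneTwo (2 * r + 1)) := by
  classical
  set T := G.induce S with hTdef
  have tri := fun u v w => hT.connected.dist_triangle (u := u) (v := v) (w := w)
  have comm := fun u v => SimpleGraph.dist_comm (G := T) (u := u) (v := v)
  have bound : ∀ (P : S) (B : ℕ), T.dist P x1 + 1 ≤ B → T.dist P y1 + 1 ≤ B →
      T.dist P x2 ≤ B → T.dist P y2 ≤ B → ρ + 1 ≤ B := by
    intro P B b1 b2 b3 b4
    obtain ⟨v, hv⟩ := hecc P
    by_cases hvx : v = x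
    · have a1 : G.dist x1 v = 1 := dist_eq_one_iff_adj.mpr (by
        rw [hvx]; exact ((hx x1).mpr (Or.inl rfl)).symm)
      have a2 : G.dist P v ≤ G.dist P x1 + G.dist x1 v := hG.dist_triangle
      have a3 := induce_dist_le G S hT.connected P x1
      rw [← hTdef] at a3
      omega
    by_cases hvy : v = y
    · have a1 : G.dist y1 v = 1 := dist_eq_one_iff_adj.mpr (by
        rw [hvy]; exact ((hy y1).mpr (Or.inl rfl)).symm)
      have a2 : G.dist P v ≤ G.dist P y1 + G.dist y1 v := hG.dist_triangle
      have a3 := induce_dist_le G S hT.connected P y1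
      rw [← hTdef] at a3
      omega
    have hvS : v ∈ S := (hS v).mpr ⟨hvx, hvy⟩
    have a3 : G.dist P v ≤ T.dist P ⟨v, hvS⟩ := induce_dist_le G S hT.connected P ⟨v, hvS⟩
    obtain ⟨l, hl, hd⟩ := hL P ⟨v, hvS⟩
    simp only [Set.mem_insert_iff, Set.mem_singleton_iff] at hl
    rcases hl with rfl | rfl | rfl | rfl <;> omega
  have nx : T.dist x1 x2 ≠ 0 := fun h => hx12 (hT.connected.dist_eq_zero_iff.mp h)
  have ny : T.dist y1 y2 ≠ 0 := fun h => hy12 (hT.connected.dist_eq_zero_iff.mp h)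
  obtain ⟨P, p1, p2, p3⟩ := tree_median hT x1 y1 _ x2 rfl
  obtain ⟨Q, q1, q2, q3⟩ := tree_median hT x1 y2 _ x2 rfl
  have hB := fun B => bound P B
  have := comm P x1; have := comm P x2; have := comm P y1; have := comm P y2
  have spl := tree_split hT x1 x2 y2 P p1
  have pos : ∀ a b : ℕ, a ≤ max a b ∧ b ≤ max a b := by intro a b; omega
  rcases h12 with h12 | h12 <;> rcases h21 with h21 | h21
  · exfalso
    have := hB (max (T.dist x1 P) (T.dist y1 P) + 1) (by omega) (by omega) (by omega) (by omega)
    have t := tri y1 P y2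
    omega
  · omega
  · omega
  · have := hB (max (T.dist x1 P) (T.dist y1 P) + 1) (by omega) (by omega) (by omega) (by omega)
    have hor : T.dist x1 P = 0 ∨ T.dist y1 P = 0 := by omega
    rcases hor with h0 | h0
    · have hadj : T.Adj x1 x2 := dist_eq_one_iff_adj.mp (by omega)
      exact final_case G S x y hS hne hnadj x1 x2 y1 y2 hx hy hT hL ρ h11 h22 h12 h21 hadj
    · have hadj : T.Adj y1 y2 := dist_eq_one_iff_adj.mp (by
        have t := tri y1 P y2
        omega)
      refine final_case G S y x (fun v => by rw [hS v]; tauto) hne.symm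
        (fun h => hnadj h.symm) y1 y2 x1 x2 hy hx hT ?_ ρ
        (by rw [← hTdef, comm, h11]) (by rw [← hTdef, comm, h22])
        (by rw [← hTdef, comm, h21]) (by rw [← hTdef, comm, h12]) hadj
      intro P z
      obtain ⟨l, hl, hd⟩ := hL P z
      refine ⟨l, ?_, hd⟩
      simp only [Set.mem_insert_iff, Set.mem_singleton_iff] at hl ⊢
      tauto

lemma walk_avoid {V : Type*} (G : SimpleGraph V) (hG : G.Connected) (S : Set V) (x y : V) (r : ℕ)
    (hS : ∀ v, v ∈ S ↔ v ≠ x ∧ v ≠ y) (a b : S) (hab : G.dist a b ≤ r)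
    (h1 : r + 1 ≤ G.dist a x + G.dist x b) (h2 : r + 1 ≤ G.dist a y + G.dist y b) :
    (G.induce S).Reachable a b ∧ (G.induce S).dist a b ≤ G.dist a b := by
  classical
  obtain ⟨p, hp⟩ := hG.exists_walk_length_eq_dist (a : V) b
  have key : ∀ z ∈ p.support, G.dist a z + G.dist z b ≤ r := by
    intro z hz
    have e := congrArg Walk.length (p.take_spec hz)
    rw [Walk.length_append] at e
    have := dist_le (p.takeUntil z hz)
    have := dist_le (p.dropUntil z hz)
    omega
  have hsupp : ∀ z ∈ p.support, z ∈ S := by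
    intro z hz
    have := key z hz
    rw [hS]
    constructor
    · rintro rfl; omega
    · rintro rfl; omega
  let q := p.induce S hsupp
  have hq : q.length = p.length := by
    have := congrArg Walk.length (Walk.map_induce p hsupp)
    rwa [Walk.length_map] at this
  exact ⟨⟨q⟩, by rw [← hp, ← hq]; exact dist_le q⟩

lemma exists_diametral {V : Type*} [Fintype V] (G : SimpleGraph V) (hG : G.Connected)
    (hdeg : ∀ v, 2 ≤ (G.neighborSet v).ncard) (hASC : IsAlmostSelfCentered G) :
    ∃ (x y : V) (r : ℕ), x ≠ y ∧ 1 ≤ r ∧ G.dist x y = r + 1 ∧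
      (∀ u v, u ≠ x → u ≠ y → G.dist u v ≤ r) ∧ (∀ u, u ≠ x → u ≠ y → ∃ v, r ≤ G.dist u v) := by
  classical
  have hle : ∀ u v, G.dist u v ≤ graphEcc G u := fun u v =>
    Finset.le_sup (f := fun u' => G.dist u u') (Finset.mem_univ v)
  have hatt : ∀ u, ∃ v, G.dist u v = graphEcc G u := by
    intro u
    obtain ⟨v, _, hv⟩ := Finset.exists_mem_eq_sup (Finset.univ : Finset V) ⟨u, Finset.mem_univ u⟩
      (fun v => G.dist u v)
    exact ⟨v, hv.symm⟩
  have hrad : ∀ u, graphRadius G ≤ graphEcc G u := fun u => Nat.sInf_le ⟨u, rfl⟩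
  set r := graphRadius G with hr
  obtain ⟨v0⟩ := hG.nonempty
  have hcard : 2 ≤ Fintype.card V := by
    have h1 := hdeg v0
    have h2 := Set.ncard_le_card (G.neighborSet v0)
    rw [Nat.card_eq_fintype_card] at h2
    omega
  have hc : ({v : V | graphEcc G v = r}ᶜ : Set V).ncard = 2 := by
    have h1 : ({v : V | graphEcc G v = r} : Set V).ncard = Fintype.card V - 2 := by
      rw [← Nat.card_coe_set_eq]; exact hASC.2
    have h2 := Set.ncard_add_ncard_compl {v : V | graphEcc G v = r}
    rw [Nat.card_eq_fintype_card] at h2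
    omega
  obtain ⟨x, y, hxy, hset⟩ := Set.ncard_eq_two.mp hc
  have hmem : ∀ v, graphEcc G v ≠ r ↔ v = x ∨ v = y := by
    intro v
    have : v ∈ ({v : V | graphEcc G v = r}ᶜ : Set V) ↔ v ∈ ({x, y} : Set V) := by rw [hset]
    simpa using this
  have hecc : ∀ v, v ≠ x → v ≠ y → graphEcc G v = r := by
    intro v h1 h2
    by_contra h
    rcases (hmem v).mp h with h | h <;> contradiction
  have hex : r + 1 ≤ graphEcc G x := by
    have := (hmem x).mpr (Or.inl rfl); have := hrad x; omega
  obtain ⟨z, hz⟩ := hatt x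
  have hzy : z = y := by
    have h1 := hle z x
    rw [SimpleGraph.dist_comm] at h1
    rcases (hmem z).mp (by omega) with h | h
    · rw [h] at hz; simp at hz; omega
    · exact h
  subst hzy
  obtain ⟨w, hw, hwz⟩ := Set.exists_ne_of_one_lt_ncard (s := G.neighborSet x)
    (by have := hdeg x; omega) z
  have hwx : G.Adj x w := hw
  have e1 := dist_eq_one_iff_adj.mpr hwx
  have hew := hecc w hwx.ne' hwz
  have t : G.dist x z ≤ G.dist x w + G.dist w z := hG.dist_triangle
  have t1 := hle w z
  have t2 := hle w x
  rw [SimpleGraph.dist_comm] at t2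
  refine ⟨x, z, r, hxy, by omega, by omega, ?_, ?_⟩
  · intro u v h1 h2
    rw [← hecc u h1 h2]; exact hle u v
  · intro u h1 h2
    obtain ⟨v, hv⟩ := hatt u
    exact ⟨v, by rw [hv, hecc u h1 h2]⟩

lemma edge_count {V : Type*} [Fintype V] (G : SimpleGraph V) (S : Set V) (x y : V)
    (hS : ∀ v, v ∈ S ↔ v ≠ x ∧ v ≠ y) (hne : x ≠ y) (hnadj : ¬ G.Adj x y) :
    (G.induce S).edgeSet.ncard + (G.neighborSet x).ncard + (G.neighborSet y).ncard ≤
      G.edgeSet.ncard := by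
  classical
  have hinc : ∀ v, (G.incidenceSet v).ncard = (G.neighborSet v).ncard := by
    intro v
    rw [← Nat.card_coe_set_eq, ← Nat.card_coe_set_eq]
    exact Nat.card_congr (G.incidenceSetEquivNeighborSet v)
  have hinj : Function.Injective (Sym2.map (Subtype.val : S → V)) :=
    Sym2.map.injective Subtype.val_injective
  rw [← hinc x, ← hinc y, ← Set.ncard_image_of_injective _ hinj]
  have hd1 : Disjoint (Sym2.map (Subtype.val : S → V) '' (G.induce S).edgeSet)
      (G.incidenceSet x) := by
    rw [Set.disjoint_left]
    rintro _ ⟨e, _, rfl⟩ ⟨_, h⟩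
    obtain ⟨v, _, hv⟩ := Sym2.mem_map.mp h
    exact ((hS v).mp v.2).1 hv
  have hd2 : Disjoint (Sym2.map (Subtype.val : S → V) '' (G.induce S).edgeSet ∪ G.incidenceSet x)
      (G.incidenceSet y) := by
    rw [Set.disjoint_union_left]
    constructor
    · rw [Set.disjoint_left]
      rintro _ ⟨e, _, rfl⟩ ⟨_, h⟩
      obtain ⟨v, _, hv⟩ := Sym2.mem_map.mp h
      exact ((hS v).mp v.2).2 hv
    · rw [Set.disjoint_iff_inter_eq_empty]
      exact G.incidenceSet_inter_incidenceSet_of_not_adj hnadj hne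
  rw [← Set.ncard_union_eq hd1, ← Set.ncard_union_eq hd2]
  apply Set.ncard_le_ncard _ (Set.toFinite _)
  apply Set.union_subset (Set.union_subset _ (G.incidenceSet_subset x)) (G.incidenceSet_subset y)
  rintro _ ⟨e, he, rfl⟩
  induction e with
  | _ a b => exact he

theorem almostSelfCentered_of_size_eq_order_add_one {V : Type*} [Fintype V]
    (G : SimpleGraph V) (n : ℕ) (hn : Fintype.card V = n)
    (hconn : G.Connected) (hsize : G.edgeSet.ncard = n + 1) (hmin : graphMinDeg G = 2)
    (hASC : IsAlmostSelfCentered G) :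
    Even n ∧ Nonempty (G ≃g thetaOneTwo (n - 1)) := by
  classical
  have hdeg : ∀ v, 2 ≤ (G.neighborSet v).ncard := by
    intro v
    rw [← hmin]
    exact Nat.sInf_le ⟨v, rfl⟩
  obtain ⟨x, y, r, hne, hr, hxy, hle, hecc⟩ := exists_diametral G hconn hdeg hASC
  have comm := fun u v => SimpleGraph.dist_comm (G := G) (u := u) (v := v)
  have tri := fun u v w => hconn.dist_triangle (u := u) (v := v) (w := w)
  have hnadj : ¬ G.Adj x y := by
    intro h
    have := dist_eq_one_iff_adj.mpr h
    omega
  obtain ⟨S, hS⟩ : ∃ S : Set V, ∀ v, v ∈ S ↔ v ≠ x ∧ v ≠ y := ⟨{v | v ≠ x ∧ v ≠ y}, fun v => Iff.rfl⟩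
  have nbS : ∀ v, G.Adj x v ∨ G.Adj y v → v ∈ S := by
    intro v hv
    rw [hS]
    rcases hv with h | h
    · refine ⟨h.ne', ?_⟩; rintro rfl; exact hnadj h
    · refine ⟨?_, h.ne'⟩; rintro rfl; exact hnadj h.symm
  have dx : ∀ a : S, G.Adj x a → G.dist x a = 1 ∧ G.dist a y = r := by
    intro a ha
    have h1 := dist_eq_one_iff_adj.mpr ha
    have h2 := tri x a y
    have h3 := hle a y ((hS a).mp a.2).1 ((hS a).mp a.2).2
    exact ⟨h1, by omega⟩
  have dy : ∀ b : S, G.Adj y b → G.dist y b = 1 ∧ G.dist x b = r := by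
    intro b hb
    have h1 := dist_eq_one_iff_adj.mpr hb
    have h2 := tri x b y
    have h3 := hle b x ((hS b).mp b.2).1 ((hS b).mp b.2).2
    have := comm b y; have := comm b x
    exact ⟨h1, by omega⟩
  have cross : ∀ a b : S, G.Adj x a → G.Adj y b →
      (G.induce S).Reachable a b ∧ (G.induce S).dist a b ≤ G.dist a b := by
    intro a b ha hb
    have := dx a ha; have := dy b hb
    have := comm a x
    apply walk_avoid G hconn S x y r hS a b
      (hle a b ((hS a).mp a.2).1 ((hS a).mp a.2).2) <;> omega
  -- the two neighbourhoods are nonempty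
  obtain ⟨b0, hb0⟩ : ∃ b : S, G.Adj y b := by
    obtain ⟨w, hw, _⟩ := Set.exists_ne_of_one_lt_ncard (s := G.neighborSet y)
      (by have := hdeg y; omega) x
    exact ⟨⟨w, nbS w (Or.inr hw)⟩, hw⟩
  have hreach : ∀ (k : ℕ) (z : S), G.dist x z = k → (G.induce S).Reachable z b0 := by
    intro k
    induction k with
    | zero =>
      intro z hz
      exact absurd (hconn.dist_eq_zero_iff.mp hz).symm ((hS z).mp z.2).1
    | succ k ih =>
      intro z hz
      obtain ⟨w, hw, hwd⟩ := exists_closer hconn x z ((hS z).mp z.2).1.symm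
      by_cases hwx : w = x
      · rw [hwx] at hw
        exact (cross z b0 hw.symm hb0).1
      by_cases hwy : w = y
      · exfalso
        rw [hwy] at hwd
        have := hle z x ((hS z).mp z.2).1 ((hS z).mp z.2).2
        have := comm z x
        omega
      have hwS : w ∈ S := (hS w).mpr ⟨hwx, hwy⟩
      have h1 : (G.induce S).Adj z ⟨w, hwS⟩ := hw
      exact h1.reachable.trans (ih ⟨w, hwS⟩ (by simp only; omega))
  have hTconn : (G.induce S).Connected :=
    { preconnected := fun a b => (hreach _ a rfl).trans (hreach _ b rfl).symm
      nonempty := ⟨b0⟩ }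
  have hScard : Nat.card S + 2 = n := by
    have h1 : Sᶜ = {x, y} := by
      ext v
      simp only [Set.mem_compl_iff, hS, Set.mem_insert_iff, Set.mem_singleton_iff]
      tauto
    have h2 := Set.ncard_add_ncard_compl S
    rw [h1, Set.ncard_pair hne, Nat.card_eq_fintype_card, hn] at h2
    exact h2
  have hE1 := hTconn.card_vert_le_card_edgeSet_add_one
  have hE2 := edge_count G S x y hS hne hnadj
  rw [Nat.card_coe_set_eq (G.induce S).edgeSet] at hE1
  have hdx := hdeg x
  have hdy := hdeg y
  have hT : (G.induce S).IsTree := by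
    rw [isTree_iff_connected_and_card]
    refine ⟨hTconn, ?_⟩
    rw [Nat.card_coe_set_eq (G.induce S).edgeSet]
    omega
  obtain ⟨x1, x2, hx12, hxs⟩ := Set.ncard_eq_two.mp (show (G.neighborSet x).ncard = 2 by omega)
  obtain ⟨y1, y2, hy12, hys⟩ := Set.ncard_eq_two.mp (show (G.neighborSet y).ncard = 2 by omega)
  have hx : ∀ v, G.Adj x v ↔ v = x1 ∨ v = x2 := by
    intro v
    rw [← mem_neighborSet, hxs]; simp
  have hy : ∀ v, G.Adj y v ↔ v = y1 ∨ v = y2 := by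
    intro v
    rw [← mem_neighborSet, hys]; simp
  obtain ⟨x1, rfl⟩ : ∃ a : S, (a : V) = x1 := ⟨⟨x1, nbS x1 (Or.inl ((hx _).mpr (Or.inl rfl)))⟩, rfl⟩
  obtain ⟨x2, rfl⟩ : ∃ a : S, (a : V) = x2 := ⟨⟨x2, nbS x2 (Or.inl ((hx _).mpr (Or.inr rfl)))⟩, rfl⟩
  obtain ⟨y1, rfl⟩ : ∃ a : S, (a : V) = y1 := ⟨⟨y1, nbS y1 (Or.inr ((hy _).mpr (Or.inl rfl)))⟩, rfl⟩
  obtain ⟨y2, rfl⟩ : ∃ a : S, (a : V) = y2 := ⟨⟨y2, nbS y2 (Or.inr ((hy _).mpr (Or.inr rfl)))⟩, rfl⟩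
  have hx12' : x1 ≠ x2 := fun h => hx12 (congrArg _ h)
  have hy12' : y1 ≠ y2 := fun h => hy12 (congrArg _ h)
  have ax1 : G.Adj x x1 := (hx _).mpr (Or.inl rfl)
  have ax2 : G.Adj x x2 := (hx _).mpr (Or.inr rfl)
  have ay1 : G.Adj y y1 := (hy _).mpr (Or.inl rfl)
  have ay2 : G.Adj y y2 := (hy _).mpr (Or.inr rfl)
  obtain ⟨ρ, rfl⟩ : ∃ ρ, r = ρ + 1 := ⟨r - 1, by omega⟩
  have heq : ∀ a b : S, G.Adj x a → G.Adj y b → (G.induce S).dist a b = G.dist a b := by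
    intro a b ha hb
    exact le_antisymm (cross a b ha hb).2 (induce_dist_le G S hTconn a b)
  have two : ∀ a b : S, G.Adj x a → G.Adj y b →
      (G.induce S).dist a b = ρ ∨ (G.induce S).dist a b = ρ + 1 := by
    intro a b ha hb
    rw [heq a b ha hb]
    have := hle a b ((hS a).mp a.2).1 ((hS a).mp a.2).2
    have := dx a ha; have := dy b hb; have := tri a b y; have := comm b y
    omega
  have row : ∀ a : S, G.Adj x a → (G.induce S).dist a y1 = ρ ∨ (G.induce S).dist a y2 = ρ := by
    intro a ha
    rw [heq a y1 ha ay1, heq a y2 ha ay2]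
    obtain ⟨u, hu, hud⟩ := exists_closer hconn (a : V) y ((hS a).mp a.2).2
    have := dx a ha
    rcases (hy u).mp hu with rfl | rfl
    · left; omega
    · right; omega
  have col : ∀ b : S, G.Adj y b → (G.induce S).dist x1 b = ρ ∨ (G.induce S).dist x2 b = ρ := by
    intro b hb
    rw [heq x1 b ax1 hb, heq x2 b ax2 hb]
    obtain ⟨u, hu, hud⟩ := exists_closer hconn (b : V) x ((hS b).mp b.2).1
    have := dy b hb
    have := comm x b; have := comm b x1; have := comm b x2
    rcases (hx u).mp hu with rfl | rfl
    · left; omega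
    · right; omega
  have hL : ∀ P z, ∃ l ∈ ({x1, x2, y1, y2} : Set S),
      (G.induce S).dist P z + (G.induce S).dist z l = (G.induce S).dist P l := by
    intro P z
    apply tree_extend hT
    intro z hz
    simp only [Set.mem_insert_iff, Set.mem_singleton_iff, not_or] at hz
    have hzx : ¬ G.Adj z x := by
      intro h
      rcases (hx z).mp h.symm with h | h
      · exact hz.1 (Subtype.ext h)
      · exact hz.2.1 (Subtype.ext h)
    have hzy : ¬ G.Adj z y := by
      intro h
      rcases (hy z).mp h.symm with h | h
      · exact hz.2.2.1 (Subtype.ext h)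
      · exact hz.2.2.2 (Subtype.ext h)
    have hz2 := hdeg z
    obtain ⟨u, hu, _⟩ := Set.exists_ne_of_one_lt_ncard (s := G.neighborSet (z : V)) (by omega) x
    obtain ⟨v, hv, hvu⟩ := Set.exists_ne_of_one_lt_ncard (s := G.neighborSet (z : V)) (by omega) u
    have hin : ∀ w, G.Adj z w → w ∈ S := by
      intro w hw
      rw [hS]
      constructor
      · rintro rfl; exact hzx hw
      · rintro rfl; exact hzy hw
    exact ⟨⟨u, hin u hu⟩, ⟨v, hin v hv⟩, fun h => hvu (congrArg Subtype.val h).symm, hu, hv⟩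
  have hecc' : ∀ P : S, ∃ v, ρ + 1 ≤ G.dist P v := fun P =>
    hecc P ((hS P).mp P.2).1 ((hS P).mp P.2).2
  have main : ∃ r, Fintype.card V = 2 * r + 2 ∧ Nonempty (G ≃g thetaOneTwo (2 * r + 1)) := by
    by_cases hp : (G.induce S).dist x1 y1 = ρ ∧ (G.induce S).dist x2 y2 = ρ
    · exact middle_case G hconn S x y hS hne hnadj x1 x2 y1 y2 hx hy hx12' hy12' hT hL ρ hp.1 hp.2
        (two x1 y2 ax1 ay2) (two x2 y1 ax2 ay1) hecc'
    · have hq : (G.induce S).dist x1 y2 = ρ ∧ (G.induce S).dist x2 y1 = ρ := by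
        have := row x1 ax1; have := row x2 ax2; have := col y1 ay1; have := col y2 ay2
        tauto
      refine middle_case G hconn S x y hS hne hnadj x1 x2 y2 y1 hx (fun v => by rw [hy v]; tauto)
        hx12' hy12'.symm hT ?_ ρ hq.1 hq.2
        (two x1 y1 ax1 ay1) (two x2 y2 ax2 ay2) hecc'
      intro P z
      obtain ⟨l, hl, hd⟩ := hL P z
      refine ⟨l, ?_, hd⟩
      simp only [Set.mem_insert_iff, Set.mem_singleton_iff] at hl ⊢
      tauto
  obtain ⟨s, hs, hiso⟩ := main
  have hns : n = 2 * s + 2 := by omega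
  subst hns
  exact ⟨⟨s + 1, by omega⟩, hiso⟩
end
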